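/- arXiv:1605.09412 — 9 statements merged into one kernel-verified Lean document; each statement's English description precedes it below -/
import Mathlib

section
/- Let p : S̄ → [2,∞) and set p⁻ = min_{x∈S} p(x). For every u ∈ A one has ∑_{x∈S} |u(x)|^{p(x)} ≥ 2^{−p⁻/2} · |∂S|^{p⁻/2} · |S̄|^{1−p⁻} · ‖u‖^{p⁻} − |S|. -/
open Finset

/-- Lowering the exponent of a power of a nonnegative real costs at most an additive `1`. -/
lemma rpow_sub_one_le_rpow {a q r : ℝ} (ha : 0 ≤ a) (hq : 0 ≤ q) (hqr : q ≤ r) :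
    a ^ q - 1 ≤ a ^ r := by
  rcases le_total a 1 with h | h
  · linarith [Real.rpow_le_one ha h hq, Real.rpow_nonneg ha r]
  · linarith [Real.rpow_le_rpow_of_exponent_le h hqr]

/-- Comparison of the Euclidean norm with the `q`-norm for `2 ≤ q`. -/
lemma sqrt_sum_sq_rpow_le {ι : Type*} (s : Finset ι) (u : ι → ℝ) {q : ℝ} (hq : 2 ≤ q) :
    Real.sqrt (∑ x ∈ s, u x ^ 2) ^ q ≤ (s.card : ℝ) ^ (q / 2 - 1) * ∑ x ∈ s, |u x| ^ q := by
  have h := Real.rpow_sum_le_const_mul_sum_rpow s (fun x => u x ^ 2)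
    (show 1 ≤ q / 2 by linarith)
  have hsq (x : ι) : |u x ^ 2| ^ (q / 2) = |u x| ^ q := by
    rw [abs_pow, ← Real.rpow_natCast, ← Real.rpow_mul (abs_nonneg _)]
    congr 1
    push_cast
    ring
  simp only [hsq] at h
  simp only [abs_pow, sq_abs] at h
  rwa [Real.sqrt_eq_rpow, ← Real.rpow_mul (sum_nonneg fun x _ => sq_nonneg _),
    one_div_mul_eq_div]

/-- **(a.4)** Let `p : S̄ → [2,∞)` and `p⁻ = min_{x∈S} p(x)`.  For every `u ∈ A`,
`∑_{x∈S} |u(x)|^{p(x)} ≥ 2^{−p⁻/2} · |∂S|^{p⁻/2} · |S̄|^{1−p⁻} · ‖u‖^{p⁻} − |S|`. -/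
theorem stmt_3 {V : Type*} [Fintype V] [DecidableEq V]
    (S B : Finset V) (hS : S.Nonempty) (hB : B.Nonempty)
    (hdisj : Disjoint S B) (hcover : S ∪ B = Finset.univ)
    (p : V → ℝ) (hp : ∀ x, 2 ≤ p x)
    (u : V → ℝ) (hu : ∀ x ∈ B, u x = 0) :
    (2 : ℝ) ^ (-(S.inf' hS p / 2)) * (B.card : ℝ) ^ (S.inf' hS p / 2) *
        (Fintype.card V : ℝ) ^ (1 - S.inf' hS p) *
        Real.sqrt (∑ x, u x ^ 2) ^ (S.inf' hS p) - (S.card : ℝ)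
      ≤ ∑ x ∈ S, |u x| ^ (p x) := by
  set q := S.inf' hS p
  have hq : 2 ≤ q := le_inf' hS p fun x _ => hp x
  have hn : (0 : ℝ) < Fintype.card V := by
    have : Nonempty V := ⟨hS.choose⟩
    exact_mod_cast Fintype.card_pos
  have hsum : ∑ x, |u x| ^ q = ∑ x ∈ S, |u x| ^ q := by
    rw [← hcover, sum_union hdisj, add_eq_left]
    exact sum_eq_zero fun x hx => by
      rw [hu x hx, abs_zero, Real.zero_rpow (by linarith)]
  have hnorm := sqrt_sum_sq_rpow_le univ u hq
  rw [card_univ, hsum] at hnorm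
  have hT : 0 ≤ ∑ x ∈ S, |u x| ^ q := sum_nonneg fun x _ => by positivity
  have htwo : (2 : ℝ) ^ (-(q / 2)) ≤ 1 :=
    Real.rpow_le_one_of_one_le_of_nonpos (by norm_num) (by linarith)
  have hcard : (B.card : ℝ) ^ (q / 2) ≤ (Fintype.card V : ℝ) ^ (q / 2) :=
    Real.rpow_le_rpow (by positivity) (by exact_mod_cast card_le_univ B) (by linarith)
  have hmain : (2 : ℝ) ^ (-(q / 2)) * (B.card : ℝ) ^ (q / 2) * (Fintype.card V : ℝ) ^ (1 - q) *
      Real.sqrt (∑ x, u x ^ 2) ^ q ≤ ∑ x ∈ S, |u x| ^ q :=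
    calc
      _ ≤ 1 * (Fintype.card V : ℝ) ^ (q / 2) * (Fintype.card V : ℝ) ^ (1 - q) *
          ((Fintype.card V : ℝ) ^ (q / 2 - 1) * ∑ x ∈ S, |u x| ^ q) := by gcongr
      _ = ∑ x ∈ S, |u x| ^ q := by
        rw [one_mul, ← mul_assoc, ← Real.rpow_add hn, ← Real.rpow_add hn,
          show q / 2 + (1 - q) + (q / 2 - 1) = 0 by ring, Real.rpow_zero, one_mul]
  have hlow : ∑ x ∈ S, (|u x| ^ q - 1) ≤ ∑ x ∈ S, |u x| ^ p x :=
    sum_le_sum fun x hx =>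
      rpow_sub_one_le_rpow (abs_nonneg _) (by linarith) (inf'_le p hx)
  rw [sum_sub_distrib, sum_const, nsmul_eq_mul, mul_one] at hlow
  linarith
end

section
/- For every u ∈ A and every real m ≥ 2, one has ∑_{x∈S̄} ∑_{y∈S̄} |u(y) − u(x)|^m ≥ 2^{m/2} · |∂S|^{m/2} · |S̄|^{2−m} · ‖u‖^m. -/
open Finset

/-- Pairs with one vertex in a set `B` where `u` vanishes already contribute `2 |B| ‖u‖²` to the
sum of all squared differences of `u`. -/
theorem two_mul_card_mul_sum_sq_le_sum_sq_sub {V : Type*} [Fintype V] [DecidableEq V]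
    (B : Finset V) (u : V → ℝ) (hu : ∀ x ∈ B, u x = 0) :
    2 * (B.card : ℝ) * ∑ x, u x ^ 2 ≤ ∑ x, ∑ y, |u y - u x| ^ 2 := by
  have h : ∀ x y, (if x ∈ B then 1 else 0) * u y ^ 2 + u x ^ 2 * (if y ∈ B then 1 else 0)
      ≤ |u y - u x| ^ 2 := by
    intro x y
    rw [sq_abs]
    by_cases hx : x ∈ B <;> by_cases hy : y ∈ B <;> simp [hx, hy, hu, sq_nonneg]
  calc 2 * (B.card : ℝ) * ∑ x, u x ^ 2
      = ∑ x, ∑ y, ((if x ∈ B then 1 else 0) * u y ^ 2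
          + u x ^ 2 * (if y ∈ B then 1 else 0)) := by
        simp only [sum_add_distrib, ← mul_sum, ← sum_mul, sum_boole, filter_univ_mem]
        ring
    _ ≤ _ := sum_le_sum fun x _ => sum_le_sum fun y _ => h x y

/-- For every `u ∈ A` and every real `m ≥ 2`,
`∑_{x,y∈S̄} |u(y)−u(x)|^m ≥ 2^{m/2} · |∂S|^{m/2} · |S̄|^{2−m} · ‖u‖^m`. -/
theorem stmt_8 {V : Type*} [Fintype V] [DecidableEq V]
    (S B : Finset V) (hS : S.Nonempty) (hB : B.Nonempty)
    (hdisj : Disjoint S B) (hcover : S ∪ B = Finset.univ)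
    (u : V → ℝ) (hu : ∀ x ∈ B, u x = 0)
    (m : ℝ) (hm : 2 ≤ m) :
    (2 : ℝ) ^ (m / 2) * (B.card : ℝ) ^ (m / 2) *
        (Fintype.card V : ℝ) ^ (2 - m) * Real.sqrt (∑ x, u x ^ 2) ^ m
      ≤ ∑ x, ∑ y, |u y - u x| ^ m := by
  have hN : (0 : ℝ) < Fintype.card V := by
    obtain ⟨x, _⟩ := hB
    exact_mod_cast Fintype.card_pos_iff.mpr ⟨x⟩
  have hQ : 0 ≤ ∑ x, u x ^ 2 := sum_nonneg fun x _ => sq_nonneg _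
  have hpow : ∀ a : ℝ, (|a| ^ 2) ^ (m / 2) = |a| ^ m := fun a => by
    rw [← Real.rpow_natCast, ← Real.rpow_mul (abs_nonneg a)]
    congr 1
    push_cast
    ring
  have hmean := Real.rpow_sum_le_const_mul_sum_rpow (univ : Finset (V × V))
    (fun p => |u p.2 - u p.1| ^ 2) (p := m / 2) (by linarith)
  simp only [abs_pow, abs_abs, hpow, Fintype.sum_prod_type, card_univ, Fintype.card_prod,
    Nat.cast_mul] at hmean
  have hcard : ((Fintype.card V : ℝ) * Fintype.card V) ^ (m / 2 - 1)
      = (Fintype.card V : ℝ) ^ (m - 2) := by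
    rw [Real.mul_rpow hN.le hN.le, ← Real.rpow_add hN]
    congr 1
    ring
  rw [hcard] at hmean
  have hsqrt : Real.sqrt (∑ x, u x ^ 2) ^ m = (∑ x, u x ^ 2) ^ (m / 2) := by
    rw [Real.sqrt_eq_rpow, ← Real.rpow_mul hQ]
    congr 1
    ring
  have hlow := (Real.rpow_le_rpow (by positivity)
    (two_mul_card_mul_sum_sq_le_sum_sq_sub B u hu) (by linarith : 0 ≤ m / 2)).trans hmean
  rw [Real.mul_rpow (by positivity) hQ, Real.mul_rpow (by norm_num) (by positivity)] at hlow
  rw [hsqrt, ← neg_sub m 2, Real.rpow_neg hN.le, mul_right_comm, ← div_eq_mul_inv,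
    div_le_iff₀' (by positivity)]
  exact hlow
end

section
/- (Discrete maximum principle) Assume f(x,t) > 0 for all x ∈ S and all t ≥ 0. If u ∈ A satisfies −Δ_{p(x),ω}u(x) + q(x)|u(x)|^{p(x)−2}u(x) = λ f(x, u₊(x)) for all x ∈ S, then u(x) > 0 for all x ∈ S; consequently u is a positive solution of the problem −Δ_{p(x),ω}u(x) + q(x)|u(x)|^{p(x)−2}u(x) = λ f(x, u(x)) on S with u = 0 on ∂S. -/
open Finset

/-- Discrete maximum principle: if `f(x,t) > 0` for all `x ∈ S`, `t ≥ 0`, and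
`u ∈ A` solves `−Δ_{p(x),ω}u(x) + q(x)|u(x)|^{p(x)−2}u(x) = λ f(x, u₊(x))` on
`S`, then `u(x) > 0` for all `x ∈ S` and `u` is a positive solution of the
problem with nonlinearity `f(x, u(x))`. -/
theorem stmt_12 {V : Type*} [Fintype V] [DecidableEq V]
    (S B : Finset V) (hS : S.Nonempty) (hB : B.Nonempty)
    (hdisj : Disjoint S B) (hcover : S ∪ B = Finset.univ)
    (ω : V → V → ℝ) (hsym : ∀ x y, ω x y = ω y x) (hnn : ∀ x y, 0 ≤ ω x y)
    (p : V → ℝ) (hp : ∀ x, 2 ≤ p x)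
    (q : V → ℝ) (hq : ∀ x ∈ S, 0 < q x)
    (lam : ℝ) (hlam : 0 < lam)
    (f : V → ℝ → ℝ) (hfc : ∀ x ∈ S, Continuous (f x))
    (hfpos : ∀ x ∈ S, ∀ t : ℝ, 0 ≤ t → 0 < f x t)
    (u : V → ℝ) (hu : ∀ x ∈ B, u x = 0)
    (hsol : ∀ x ∈ S,
      -(∑ y, |u y - u x| ^ (p x - 2) * (u y - u x) * ω x y)
        + q x * |u x| ^ (p x - 2) * u x = lam * f x (max (u x) 0)) :
    (∀ x ∈ S, 0 < u x) ∧
      (∀ x ∈ S,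
        -(∑ y, |u y - u x| ^ (p x - 2) * (u y - u x) * ω x y)
          + q x * |u x| ^ (p x - 2) * u x = lam * f x (u x)) := by
  have hpos : ∀ x ∈ S, 0 < u x := by
    obtain ⟨m, hmS, hmin⟩ := S.exists_min_image u hS
    suffices hm : 0 < u m from fun x hx => hm.trans_le (hmin x hx)
    by_contra! hm
    have hle : ∀ y, u m ≤ u y := fun y => by
      have hy : y ∈ S ∪ B := hcover ▸ Finset.mem_univ y
      rcases Finset.mem_union.1 hy with hy | hy
      · exact hmin y hy
      · rwa [hu y hy]
    have hsum : 0 ≤ ∑ y, |u y - u m| ^ (p m - 2) * (u y - u m) * ω m y :=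
      Finset.sum_nonneg fun y _ =>
        mul_nonneg (mul_nonneg (Real.rpow_nonneg (abs_nonneg _) _) (sub_nonneg.2 (hle y)))
          (hnn m y)
    have hterm : q m * |u m| ^ (p m - 2) * u m ≤ 0 :=
      mul_nonpos_of_nonneg_of_nonpos
        (mul_nonneg (hq m hmS).le (Real.rpow_nonneg (abs_nonneg _) _)) hm
    have hrhs : 0 < lam * f m (max (u m) 0) :=
      mul_pos hlam (hfpos m hmS _ (le_max_right _ _))
    linarith [hsol m hmS]
  refine ⟨hpos, fun x hx => ?_⟩
  rw [hsol x hx, max_eq_left (hpos x hx).le]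
end

section
/- Assume condition (f.1) and m₂⁺ < p⁻, where m₂⁺ = max_{x∈S} m₂(x) and p⁻ = min_{x∈S} p(x). Then for every λ > 0 the action functional J is coercive on A, i.e., J(u) → +∞ as ‖u‖ → ∞. -/
open Finset

/-- A lower power is dominated by any positive multiple of a higher power, up to a constant. -/
theorem exists_mul_rpow_le_mul_rpow_add {a b m r : ℝ} (ha : 0 < a) (hb : 0 ≤ b) (hm : 0 ≤ m)
    (hmr : m < r) : ∃ C : ℝ, ∀ s : ℝ, 0 ≤ s → b * s ^ m ≤ a * s ^ r + C := by
  have hd : 0 < r - m := sub_pos.2 hmr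
  have hba : 0 ≤ b / a := div_nonneg hb ha.le
  set K : ℝ := (b / a) ^ (r - m)⁻¹ with hK
  have hK0 : 0 ≤ K := Real.rpow_nonneg hba _
  have hC : 0 ≤ b * K ^ m := mul_nonneg hb (Real.rpow_nonneg hK0 _)
  refine ⟨b * K ^ m, fun s hs => ?_⟩
  have hsr : 0 ≤ a * s ^ r := mul_nonneg ha.le (Real.rpow_nonneg hs _)
  rcases le_or_gt s K with h | h
  · have := mul_le_mul_of_nonneg_left (Real.rpow_le_rpow hs h hm) hb
    linarith
  · have hs0 : 0 < s := hK0.trans_lt h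
    have h1 : b / a ≤ s ^ (r - m) := by
      have := Real.rpow_le_rpow hK0 h.le hd.le
      rwa [hK, Real.rpow_inv_rpow hba hd.ne'] at this
    have h2 : b ≤ a * s ^ (r - m) := by
      rwa [div_le_iff₀' ha] at h1
    have h3 : s ^ r = s ^ (r - m) * s ^ m := by
      rw [← Real.rpow_add hs0, sub_add_cancel]
    have h4 := mul_le_mul_of_nonneg_right h2 (Real.rpow_nonneg hs m)
    rw [h3]
    linarith

/-- If `g` is nonnegative and grows at most like a power on `[0, ∞)`, then so does its
primitive, with the exponent raised by one. -/
theorem integral_zero_max_le {g : ℝ → ℝ} {φ ψ m : ℝ} (hφ : 0 ≤ φ) (hψ : 0 ≤ ψ) (hm : 1 ≤ m)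
    (hg0 : ∀ t, 0 ≤ t → 0 ≤ g t) (hg : ∀ t, 0 ≤ t → g t ≤ φ * t ^ (m - 1) + ψ) (t : ℝ) :
    ∫ s in (0 : ℝ)..(max t 0), g s ≤ φ * |t| ^ m + ψ * |t| := by
  rcases le_or_gt t 0 with ht | ht
  · rw [max_eq_right ht, intervalIntegral.integral_same]
    positivity
  · rw [max_eq_left ht.le, abs_of_pos ht]
    have h : ∀ s ∈ Set.uIoc 0 t, ‖g s‖ ≤ φ * t ^ (m - 1) + ψ := by
      intro s hs
      rw [Set.uIoc_of_le ht.le] at hs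
      rw [Real.norm_of_nonneg (hg0 s hs.1.le)]
      have := mul_le_mul_of_nonneg_left
        (Real.rpow_le_rpow hs.1.le hs.2 (sub_nonneg.2 hm)) hφ
      linarith [hg s hs.1.le]
    have h1 := (Real.le_norm_self _).trans (intervalIntegral.norm_integral_le_of_norm_le_const h)
    have h2 : t ^ m = t ^ (m - 1) * t := by
      rw [← Real.rpow_add_one ht.ne', sub_add_cancel]
    rw [sub_zero, abs_of_pos ht] at h1
    rw [h2]
    linarith

/-- A power with positive coefficient minus a primitive of strictly lower growth is bounded
below by `|t|` up to a constant. -/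
theorem exists_abs_sub_le_mul_rpow_sub_integral {g : ℝ → ℝ} {a c φ ψ m r : ℝ} (ha : 0 < a)
    (hc : 0 ≤ c) (hφ : 0 ≤ φ) (hψ : 0 ≤ ψ) (hm : 1 ≤ m) (hmr : m < r)
    (hg0 : ∀ t, 0 ≤ t → 0 ≤ g t) (hg : ∀ t, 0 ≤ t → g t ≤ φ * t ^ (m - 1) + ψ) :
    ∃ C : ℝ, ∀ t : ℝ, |t| - C ≤ a * |t| ^ r - c * ∫ s in (0 : ℝ)..(max t 0), g s := by
  obtain ⟨C₁, h₁⟩ := exists_mul_rpow_le_mul_rpow_add (half_pos ha) (mul_nonneg hc hφ)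
    (zero_le_one.trans hm) hmr
  obtain ⟨C₂, h₂⟩ := exists_mul_rpow_le_mul_rpow_add (b := c * ψ + 1) (half_pos ha)
    (by positivity) zero_le_one (hm.trans_lt hmr)
  refine ⟨C₁ + C₂, fun t => ?_⟩
  have h3 := mul_le_mul_of_nonneg_left (integral_zero_max_le hφ hψ hm hg0 hg t) hc
  have h4 := h₁ |t| (abs_nonneg t)
  have h5 := h₂ |t| (abs_nonneg t)
  rw [Real.rpow_one] at h5
  linarith

/-- Under condition (f.1) and `m₂⁺ < p⁻`, for every `λ > 0` the action
functional `J` is coercive on `A`: `J(u) → +∞` as `‖u‖ → ∞`. -/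
theorem stmt_13 {V : Type*} [Fintype V] [DecidableEq V]
    (S B : Finset V) (hS : S.Nonempty) (hB : B.Nonempty)
    (hdisj : Disjoint S B) (hcover : S ∪ B = Finset.univ)
    (ω : V → V → ℝ) (hsym : ∀ x y, ω x y = ω y x) (hnn : ∀ x y, 0 ≤ ω x y)
    (p : V → ℝ) (hp : ∀ x, 2 ≤ p x)
    (q : V → ℝ) (hq : ∀ x ∈ S, 0 < q x)
    (f : V → ℝ → ℝ) (hfc : ∀ x ∈ S, Continuous (f x))
    -- condition (f.1)
    (m1 m2 φ1 φ2 ψ1 ψ2 : V → ℝ)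
    (hm1 : ∀ x ∈ S, 2 ≤ m1 x) (hm2 : ∀ x ∈ S, 2 ≤ m2 x)
    (hφ1 : ∀ x ∈ S, 0 < φ1 x) (hφ2 : ∀ x ∈ S, 0 < φ2 x)
    (hψ1 : ∀ x ∈ S, 0 < ψ1 x) (hψ2 : ∀ x ∈ S, 0 < ψ2 x)
    (hf1 : ∀ x ∈ S, ∀ t : ℝ, 0 ≤ t →
      ψ1 x + φ1 x * t ^ (m1 x - 1) ≤ f x t ∧ f x t ≤ φ2 x * t ^ (m2 x - 1) + ψ2 x)
    -- m₂⁺ < p⁻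
    (hm2p : S.sup' hS m2 < S.inf' hS p)
    (lam : ℝ) (hlam : 0 < lam)
    -- the action functional
    (J : (V → ℝ) → ℝ)
    (hJ : ∀ u : V → ℝ, J u =
      (1 / 2) * ∑ x, (1 / p x) * ∑ y, |u y - u x| ^ (p x) * ω x y
        + ∑ x ∈ S, (1 / p x) * q x * |u x| ^ (p x)
        - lam * ∑ x ∈ S, ∫ s in (0:ℝ)..(max (u x) 0), f x s) :
    ∀ M : ℝ, ∃ R : ℝ, ∀ u : V → ℝ, (∀ x ∈ B, u x = 0) →
      R ≤ Real.sqrt (∑ x, u x ^ 2) → M ≤ J u := by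
  intro M
  have key : ∀ x ∈ S, ∃ C : ℝ, ∀ t : ℝ, |t| - C ≤
      (1 / p x) * q x * |t| ^ (p x) - lam * ∫ s in (0 : ℝ)..(max t 0), f x s := by
    intro x hx
    have hp0 : 0 < p x := by linarith [hp x]
    refine exists_abs_sub_le_mul_rpow_sub_integral (mul_pos (one_div_pos.2 hp0) (hq x hx)) hlam.le
      (hφ2 x hx).le (hψ2 x hx).le (by linarith [hm2 x hx])
      ((Finset.le_sup' m2 hx).trans_lt (hm2p.trans_le (Finset.inf'_le p hx)))
      (fun t ht => ?_) (fun t ht => (hf1 x hx t ht).2)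
    have h1 := mul_nonneg (hφ1 x hx).le (Real.rpow_nonneg ht (m1 x - 1))
    linarith [(hf1 x hx t ht).1, hψ1 x hx]
  choose! C hC using key
  refine ⟨M + ∑ x ∈ S, C x, fun u hu hR => ?_⟩
  have hnorm : Real.sqrt (∑ x, u x ^ 2) ≤ ∑ x ∈ S, |u x| := by
    have hsum : ∑ x, u x ^ 2 = ∑ x ∈ S, |u x| ^ 2 := by
      simp_rw [sq_abs]
      refine (Finset.sum_subset (Finset.subset_univ S) fun x _ hx => ?_).symm
      have hxB : x ∈ B := (Finset.mem_union.1 (hcover ▸ Finset.mem_univ x)).resolve_left hx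
      rw [hu x hxB, zero_pow two_ne_zero]
    rw [hsum]
    exact Real.sqrt_le_iff.2 ⟨Finset.sum_nonneg fun x _ => abs_nonneg _,
      Finset.sum_sq_le_sq_sum_of_nonneg fun x _ => abs_nonneg _⟩
  have hgrad : 0 ≤ (1 / 2) * ∑ x, (1 / p x) * ∑ y, |u y - u x| ^ (p x) * ω x y := by
    refine mul_nonneg (by norm_num) (Finset.sum_nonneg fun x _ => mul_nonneg ?_
      (Finset.sum_nonneg fun y _ => mul_nonneg (Real.rpow_nonneg (abs_nonneg _) _) (hnn x y)))
    exact one_div_nonneg.2 (by linarith [hp x])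
  have hlow := Finset.sum_le_sum fun x (hx : x ∈ S) => hC x hx (u x)
  rw [Finset.sum_sub_distrib, Finset.sum_sub_distrib, ← Finset.mul_sum] at hlow
  rw [hJ u]
  linarith
end

section
/- Assume condition (f.1) and m₂⁺ < p⁻, where m₂⁺ = max_{x∈S} m₂(x) and p⁻ = min_{x∈S} p(x). Then for every λ > 0 the problem −Δ_{p(x),ω}u(x) + q(x)|u(x)|^{p(x)−2}u(x) = λ f(x, u(x)) on S, u = 0 on ∂S, has at least one positive solution. -/
open Finset

/-- The discrete Perron method: if each `F x`, `x ∈ S`, is continuous and is antitone in the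
coordinates other than `x`, then a zero of the system `F x u = 0`, `x ∈ S`, lies between any
subsolution `v` and any strict supersolution `w` that agree off `S`. -/
theorem exists_eq_zero_of_subsolution_of_supersolution {V : Type*} [Fintype V] [DecidableEq V]
    (S : Finset V) (F : V → (V → ℝ) → ℝ) (hF : ∀ x ∈ S, Continuous (F x))
    (hanti : ∀ x ∈ S, ∀ u u' : V → ℝ, u ≤ u' → u x = u' x → F x u' ≤ F x u)
    {v w : V → ℝ} (hvw : v ≤ w) (hv : ∀ x ∈ S, F x v ≤ 0) (hw : ∀ x ∈ S, 0 < F x w) :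
    ∃ u, v ≤ u ∧ u ≤ w ∧ ∀ x ∈ S, F x u = 0 := by
  have hclosed : IsClosed {u : V → ℝ | ∀ x ∈ S, F x u ≤ 0} := by
    simp only [Set.ofPred_forall]
    exact isClosed_biInter fun x hx => isClosed_le (hF x hx) continuous_const
  obtain ⟨u, ⟨⟨hvu, huw⟩, hu⟩, hmax⟩ :=
    ((isCompact_Icc (a := v) (b := w)).inter_right hclosed).exists_isMaxOn
      ⟨v, ⟨le_rfl, hvw⟩, hv⟩
      (f := fun u : V → ℝ => ∑ x, u x) (by fun_prop)
  refine ⟨u, hvu, huw, fun x hx => ?_⟩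
  by_contra hne
  have hlt : F x u < 0 := lt_of_le_of_ne (hu x hx) hne
  have hux : u x < w x := by
    refine lt_of_le_of_ne (huw x) fun h => ?_
    linarith [hanti x hx u w huw h, hw x hx]
  have hcont : Continuous fun t : ℝ => F x (Function.update u x t) :=
    (hF x hx).comp (continuous_const.update x continuous_id)
  have hnear : ∀ᶠ t in nhds (u x), F x (Function.update u x t) < 0 :=
    hcont.continuousAt.eventually_lt_const (by simpa using hlt)
  obtain ⟨t, ht, hut, htw⟩ :=
    ((hnear.filter_mono nhdsWithin_le_nhds).and (Ioo_mem_nhdsGT hux)).exists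
  have hle : u ≤ Function.update u x t := le_update_self_iff.2 hut.le
  have hmem : Function.update u x t ∈ Set.Icc v w ∩ {u : V → ℝ | ∀ x ∈ S, F x u ≤ 0} := by
    refine ⟨⟨hvu.trans hle, update_le_iff.2 ⟨htw.le, fun y _ => huw y⟩⟩, fun y hy => ?_⟩
    rcases eq_or_ne y x with rfl | hyx
    · exact ht.le
    · exact (hanti y hy u _ hle (by simp [hyx])).trans (hu y hy)
  have hsum : ∑ y, Function.update u x t y ≤ ∑ y, u y := hmax hmem
  have hsum' : ∑ y, u y < ∑ y, Function.update u x t y :=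
    Finset.sum_lt_sum (fun y _ => hle y) ⟨x, Finset.mem_univ x, by simpa using hut⟩
  linarith

theorem monotone_abs_rpow_mul_self {r : ℝ} (hr : 0 ≤ r) :
    Monotone fun t : ℝ => |t| ^ r * t := by
  have hodd : ∀ t : ℝ, |(-t)| ^ r * -t = -(|t| ^ r * t) := by intro t; rw [abs_neg]; ring
  refine monotone_of_odd_of_monotoneOn_nonneg hodd fun s hs t ht hst => ?_
  simp only [Set.mem_Ici] at hs ht
  simp only [abs_of_nonneg hs, abs_of_nonneg ht]
  gcongr

theorem continuous_abs_rpow_mul_self {r : ℝ} (hr : 0 ≤ r) :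
    Continuous fun t : ℝ => |t| ^ r * t :=
  (continuous_abs.rpow_const fun _ => Or.inr hr).mul continuous_id

theorem eventually_mul_rpow_add_lt_mul_rpow {m p a b c : ℝ} (hm : 0 ≤ m) (hmp : m < p)
    (hb : 0 ≤ b) (hc : 0 < c) :
    ∀ᶠ t : ℝ in Filter.atTop, a * t ^ m + b < c * t ^ p := by
  filter_upwards [(tendsto_rpow_atTop (sub_pos.2 hmp)).eventually_gt_atTop ((a + b) / c),
    Filter.eventually_ge_atTop 1] with t ht h1
  have htm : 1 ≤ t ^ m := Real.one_le_rpow h1 hm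
  have hsplit : t ^ p = t ^ (p - m) * t ^ m := by
    rw [← Real.rpow_add (by linarith)]; ring_nf
  rw [div_lt_iff₀ hc] at ht
  rw [hsplit]
  nlinarith

/-- Under condition (f.1) and `m₂⁺ < p⁻`, for every `λ > 0` the problem
`−Δ_{p(x),ω}u(x) + q(x)|u(x)|^{p(x)−2}u(x) = λ f(x,u(x))` on `S`, `u = 0` on
`∂S`, has at least one positive solution. -/
theorem stmt_14 {V : Type*} [Fintype V] [DecidableEq V]
    (S B : Finset V) (hS : S.Nonempty) (hB : B.Nonempty)
    (hdisj : Disjoint S B) (hcover : S ∪ B = Finset.univ)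
    (ω : V → V → ℝ) (hsym : ∀ x y, ω x y = ω y x) (hnn : ∀ x y, 0 ≤ ω x y)
    (p : V → ℝ) (hp : ∀ x, 2 ≤ p x)
    (q : V → ℝ) (hq : ∀ x ∈ S, 0 < q x)
    (f : V → ℝ → ℝ) (hfc : ∀ x ∈ S, Continuous (f x))
    -- condition (f.1)
    (m1 m2 φ1 φ2 ψ1 ψ2 : V → ℝ)
    (hm1 : ∀ x ∈ S, 2 ≤ m1 x) (hm2 : ∀ x ∈ S, 2 ≤ m2 x)
    (hφ1 : ∀ x ∈ S, 0 < φ1 x) (hφ2 : ∀ x ∈ S, 0 < φ2 x)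
    (hψ1 : ∀ x ∈ S, 0 < ψ1 x) (hψ2 : ∀ x ∈ S, 0 < ψ2 x)
    (hf1 : ∀ x ∈ S, ∀ t : ℝ, 0 ≤ t →
      ψ1 x + φ1 x * t ^ (m1 x - 1) ≤ f x t ∧ f x t ≤ φ2 x * t ^ (m2 x - 1) + ψ2 x)
    -- m₂⁺ < p⁻
    (hm2p : S.sup' hS m2 < S.inf' hS p)
    (lam : ℝ) (hlam : 0 < lam) :
    ∃ u : V → ℝ, (∀ x ∈ B, u x = 0) ∧ (∀ x ∈ S, 0 < u x) ∧
      ∀ x ∈ S,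
        -(∑ y, |u y - u x| ^ (p x - 2) * (u y - u x) * ω x y)
          + q x * |u x| ^ (p x - 2) * u x = lam * f x (u x) := by
  have hpm : ∀ x ∈ S, m2 x < p x := fun x hx =>
    (Finset.le_sup' m2 hx).trans_lt (hm2p.trans_le (Finset.inf'_le p hx))
  have hBS : ∀ x ∈ B, x ∉ S := fun x hxB hxS => Finset.disjoint_left.1 hdisj hxS hxB
  have hp' : ∀ x, 0 ≤ p x - 2 := fun x => sub_nonneg.2 (hp x)
  set F : V → (V → ℝ) → ℝ := fun x u =>
    -(∑ y, |u y - u x| ^ (p x - 2) * (u y - u x) * ω x y)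
      + q x * |u x| ^ (p x - 2) * u x - lam * f x (u x) with hFdef
  have hF : ∀ x ∈ S, Continuous (F x) := by
    intro x hx
    have hsum : Continuous fun u : V → ℝ =>
        ∑ y, |u y - u x| ^ (p x - 2) * (u y - u x) * ω x y :=
      continuous_finsetSum _ fun y _ =>
        ((continuous_abs_rpow_mul_self (hp' x)).comp (f := fun u : V → ℝ => u y - u x)
          (by fun_prop)).mul continuous_const
    have hpow : Continuous fun u : V → ℝ => q x * |u x| ^ (p x - 2) * u x := by
      simp only [mul_assoc]
      exact continuous_const.mul
        ((continuous_abs_rpow_mul_self (hp' x)).comp (continuous_apply x))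
    exact (hsum.neg.add hpow).sub
      (continuous_const.mul ((hfc x hx).comp (continuous_apply x)))
  have hanti : ∀ x ∈ S, ∀ u u' : V → ℝ, u ≤ u' → u x = u' x → F x u' ≤ F x u := by
    intro x _ u u' huu' hx
    simp only [hFdef, hx]
    refine sub_le_sub_right (add_le_add_left (neg_le_neg (Finset.sum_le_sum fun y _ =>
      mul_le_mul_of_nonneg_right ?_ (hnn x y))) _) _
    exact monotone_abs_rpow_mul_self (hp' x) (sub_le_sub_right (huu' y) _)
  have hzero : ∀ x ∈ S, F x 0 < 0 := by
    intro x hx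
    have h := (hf1 x hx 0 le_rfl).1
    rw [Real.zero_rpow (by linarith [hm1 x hx])] at h
    have hpos : 0 < lam * f x 0 := mul_pos hlam (by linarith [hψ1 x hx])
    simpa [hFdef] using hpos
  obtain ⟨M, hM, hM0⟩ : ∃ M : ℝ, (∀ x ∈ S,
      lam * φ2 x * M ^ (m2 x - 1) + lam * ψ2 x < q x * M ^ (p x - 1)) ∧ 0 < M :=
    (((Filter.eventually_all_finset S).2 fun x hx =>
      eventually_mul_rpow_add_lt_mul_rpow (by linarith [hm2 x hx]) (by linarith [hpm x hx])
        (mul_pos hlam (hψ2 x hx)).le (hq x hx)).and (Filter.eventually_gt_atTop 0)).exists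
  set w : V → ℝ := fun x => if x ∈ S then M else 0 with hwdef
  have hw0 : (0 : V → ℝ) ≤ w := by
    intro x
    simp only [hwdef, Pi.zero_apply]
    split_ifs <;> linarith
  have hw : ∀ x ∈ S, 0 < F x w := by
    intro x hx
    have hwx : w x = M := if_pos hx
    have hsum : ∑ y, |w y - w x| ^ (p x - 2) * (w y - w x) * ω x y ≤ 0 := by
      refine Finset.sum_nonpos fun y _ => mul_nonpos_of_nonpos_of_nonneg
        (mul_nonpos_of_nonneg_of_nonpos (by positivity) ?_) (hnn x y)
      rw [hwx]
      simp only [hwdef]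
      split_ifs <;> linarith
    have hpow : q x * |M| ^ (p x - 2) * M = q x * M ^ (p x - 1) := by
      rw [abs_of_pos hM0, mul_assoc, ← Real.rpow_add_one hM0.ne']
      ring_nf
    have hf := mul_le_mul_of_nonneg_left (hf1 x hx M hM0.le).2 hlam.le
    have := hM x hx
    rw [hwx] at hsum
    simp only [hFdef, hwx, hpow]
    linarith
  obtain ⟨u, h0u, huw, hu⟩ := exists_eq_zero_of_subsolution_of_supersolution S F hF hanti hw0
    (fun x hx => (hzero x hx).le) hw
  refine ⟨u, fun x hx => ?_, fun x hx => ?_, fun x hx => sub_eq_zero.1 (hu x hx)⟩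
  · exact le_antisymm ((huw x).trans_eq (if_neg (hBS x hx))) (h0u x)
  · refine lt_of_le_of_ne (h0u x) fun h => ?_
    linarith [hanti x hx 0 u h0u h, hzero x hx, hu x hx]
end

section
/- Assume condition (f.1) and let λ ∈ (0, λ₂), where λ₂ = [(q⁻/p⁺) · 2^{−p⁺/2} · |∂S|^{p⁺/2} · |S̄|^{1−p⁺} · |S̄|^{−p⁺/2}] / [((φ₂⁺/m₂⁻) · |S̄|^{−m₂⁻/2} + ψ₂⁺) · |S|]. Then for every u ∈ A with ‖u‖ = |S̄|^{−1/2} one has J(u) > 0; consequently inf_{u∈∂Ω} J(u) > 0, where Ω = {u ∈ A : ‖u‖ ≤ |S̄|^{−1/2}}. -/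
open Finset

/-- A continuous function dominated on `[0, ∞)` by `φ * t ^ (m - 1) + ψ` has its primitive
dominated by `φ / m * t ^ m + ψ * t`. -/
theorem integral_le_of_le_rpow_add {g : ℝ → ℝ} (hg : Continuous g) {m φ ψ t : ℝ} (hm : 1 ≤ m)
    (ht : 0 ≤ t) (h : ∀ s, 0 ≤ s → g s ≤ φ * s ^ (m - 1) + ψ) :
    ∫ s in (0 : ℝ)..t, g s ≤ φ / m * t ^ m + ψ * t := by
  have hi : IntervalIntegrable (fun s : ℝ => s ^ (m - 1)) MeasureTheory.volume 0 t :=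
    intervalIntegral.intervalIntegrable_rpow' (by linarith)
  calc ∫ s in (0 : ℝ)..t, g s ≤ ∫ s in (0 : ℝ)..t, (φ * s ^ (m - 1) + ψ) :=
        intervalIntegral.integral_mono_on ht (hg.intervalIntegrable _ _)
          ((hi.const_mul φ).add intervalIntegrable_const) fun s hs => h s hs.1
    _ = φ / m * t ^ m + ψ * t := by
        rw [intervalIntegral.integral_add (hi.const_mul φ) intervalIntegrable_const,
          intervalIntegral.integral_const_mul, integral_rpow (Or.inl (by linarith)),
          intervalIntegral.integral_const, sub_add_cancel, Real.zero_rpow (by linarith)]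
        simp only [sub_zero, smul_eq_mul]
        ring

/-- Power-mean lower bound for `∑ |u x| ^ P` in terms of `∑ u x ^ 2`, on a set of at most `N`
elements. -/
theorem rpow_mul_rpow_le_sum_abs_rpow {V : Type*} (S : Finset V) (u : V → ℝ) {P N : ℝ}
    (hP : 2 ≤ P) (hN : 0 < N) (hSN : (S.card : ℝ) ≤ N) :
    N ^ (1 - P / 2) * (∑ x ∈ S, u x ^ 2) ^ (P / 2) ≤ ∑ x ∈ S, |u x| ^ P := by
  have h1 := Real.rpow_sum_le_const_mul_sum_rpow S (fun x => u x ^ 2)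
    (show 1 ≤ P / 2 by linarith)
  have h2 : ∀ x, |u x ^ 2| ^ (P / 2) = |u x| ^ P := fun x => by
    rw [abs_pow, ← Real.rpow_natCast, ← Real.rpow_mul (abs_nonneg _)]
    congr 1
    push_cast
    ring
  simp only [h2] at h1
  simp only [abs_sq] at h1
  have h3 : (S.card : ℝ) ^ (P / 2 - 1) ≤ N ^ (P / 2 - 1) :=
    Real.rpow_le_rpow (Nat.cast_nonneg _) hSN (by linarith)
  have h4 : 0 ≤ ∑ x ∈ S, |u x| ^ P := sum_nonneg fun x _ => by positivity
  calc N ^ (1 - P / 2) * (∑ x ∈ S, u x ^ 2) ^ (P / 2)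
      ≤ N ^ (1 - P / 2) * (N ^ (P / 2 - 1) * ∑ x ∈ S, |u x| ^ P) := by
        gcongr
        exact h1.trans (mul_le_mul_of_nonneg_right h3 h4)
    _ = ∑ x ∈ S, |u x| ^ P := by
        rw [← mul_assoc, ← Real.rpow_add hN]
        simp

/-- The constant in the definition of `λ₂` is at most the power-mean constant. -/
theorem two_rpow_mul_rpow_le {b N P : ℝ} (hP : 0 ≤ P) (hb : 0 ≤ b) (hbN : b ≤ N) (hN : 0 < N) :
    (2 : ℝ) ^ (-(P / 2)) * b ^ (P / 2) * N ^ (1 - P) ≤ N ^ (1 - P / 2) := by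
  have h1 : (2 : ℝ) ^ (-(P / 2)) ≤ 1 :=
    Real.rpow_le_one_of_one_le_of_nonpos (by norm_num) (by linarith)
  have h2 : b ^ (P / 2) ≤ N ^ (P / 2) := Real.rpow_le_rpow hb hbN (by linarith)
  calc (2 : ℝ) ^ (-(P / 2)) * b ^ (P / 2) * N ^ (1 - P) ≤ 1 * N ^ (P / 2) * N ^ (1 - P) := by
        gcongr
    _ = N ^ (1 - P / 2) := by
        rw [one_mul, ← Real.rpow_add hN]
        congr 1
        ring

/-- Under condition (f.1), for `λ ∈ (0, λ₂)` one has `J(u) > 0` for every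
`u ∈ A` with `‖u‖ = |S̄|^{−1/2}`; consequently the infimum of `J` over the
sphere `∂Ω = {u ∈ A : ‖u‖ = |S̄|^{−1/2}}` is positive. -/
theorem stmt_16 {V : Type*} [Fintype V] [DecidableEq V]
    (S B : Finset V) (hS : S.Nonempty) (hB : B.Nonempty)
    (hdisj : Disjoint S B) (hcover : S ∪ B = Finset.univ)
    (ω : V → V → ℝ) (hsym : ∀ x y, ω x y = ω y x) (hnn : ∀ x y, 0 ≤ ω x y)
    (p : V → ℝ) (hp : ∀ x, 2 ≤ p x)
    (q : V → ℝ) (hq : ∀ x ∈ S, 0 < q x)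
    (f : V → ℝ → ℝ) (hfc : ∀ x ∈ S, Continuous (f x))
    -- condition (f.1)
    (m1 m2 φ1 φ2 ψ1 ψ2 : V → ℝ)
    (hm1 : ∀ x ∈ S, 2 ≤ m1 x) (hm2 : ∀ x ∈ S, 2 ≤ m2 x)
    (hφ1 : ∀ x ∈ S, 0 < φ1 x) (hφ2 : ∀ x ∈ S, 0 < φ2 x)
    (hψ1 : ∀ x ∈ S, 0 < ψ1 x) (hψ2 : ∀ x ∈ S, 0 < ψ2 x)
    (hf1 : ∀ x ∈ S, ∀ t : ℝ, 0 ≤ t →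
      ψ1 x + φ1 x * t ^ (m1 x - 1) ≤ f x t ∧ f x t ≤ φ2 x * t ^ (m2 x - 1) + ψ2 x)
    -- λ₂
    (lam2 : ℝ)
    (hlam2 : lam2 =
      (S.inf' hS q / S.sup' hS p) * (2 : ℝ) ^ (-(S.sup' hS p / 2)) *
          (B.card : ℝ) ^ (S.sup' hS p / 2) *
          (Fintype.card V : ℝ) ^ (1 - S.sup' hS p) *
          (Fintype.card V : ℝ) ^ (-(S.sup' hS p / 2)) /
        ((S.sup' hS φ2 / S.inf' hS m2 *
            (Fintype.card V : ℝ) ^ (-(S.inf' hS m2 / 2)) + S.sup' hS ψ2) *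
          (S.card : ℝ)))
    (lam : ℝ) (hlam : 0 < lam) (hlt : lam < lam2)
    -- the action functional
    (J : (V → ℝ) → ℝ)
    (hJ : ∀ u : V → ℝ, J u =
      (1 / 2) * ∑ x, (1 / p x) * ∑ y, |u y - u x| ^ (p x) * ω x y
        + ∑ x ∈ S, (1 / p x) * q x * |u x| ^ (p x)
        - lam * ∑ x ∈ S, ∫ s in (0:ℝ)..(max (u x) 0), f x s) :
    (∀ u : V → ℝ, (∀ x ∈ B, u x = 0) →
        Real.sqrt (∑ x, u x ^ 2) = (Fintype.card V : ℝ) ^ (-(1 / 2) : ℝ) →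
        0 < J u) ∧
      0 < sInf (J '' {u : V → ℝ | (∀ x ∈ B, u x = 0) ∧
          Real.sqrt (∑ x, u x ^ 2) = (Fintype.card V : ℝ) ^ (-(1 / 2) : ℝ)}) := by
  have hVN : 1 ≤ Fintype.card V := by
    obtain ⟨x, -⟩ := hS
    exact Fintype.card_pos_iff.mpr ⟨x⟩
  have hN1 : (1 : ℝ) ≤ Fintype.card V := by exact_mod_cast hVN
  have hSN : (S.card : ℝ) ≤ Fintype.card V := by exact_mod_cast S.card_le_univ
  have hBN : (B.card : ℝ) ≤ Fintype.card V := by exact_mod_cast B.card_le_univ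
  set N : ℝ := (Fintype.card V : ℝ)
  have hN : 0 < N := by linarith
  have hScard : (0 : ℝ) < S.card := by exact_mod_cast hS.card_pos
  set P := S.sup' hS p
  set Q := S.inf' hS q
  set M := S.inf' hS m2
  set Φ := S.sup' hS φ2
  set Ψ := S.sup' hS ψ2
  have hpP : ∀ x ∈ S, p x ≤ P := fun x hx => le_sup' p hx
  have hQq : ∀ x ∈ S, Q ≤ q x := fun x hx => inf'_le q hx
  have hMm : ∀ x ∈ S, M ≤ m2 x := fun x hx => inf'_le m2 hx
  have hφΦ : ∀ x ∈ S, φ2 x ≤ Φ := fun x hx => le_sup' φ2 hx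
  have hψΨ : ∀ x ∈ S, ψ2 x ≤ Ψ := fun x hx => le_sup' ψ2 hx
  have hM : 2 ≤ M := (le_inf'_iff hS m2).mpr hm2
  have hQ : 0 < Q := (lt_inf'_iff hS).mpr hq
  obtain ⟨x₀, hx₀⟩ := hS
  have hP : 2 ≤ P := (hp x₀).trans (hpP x₀ hx₀)
  have hΦ : 0 < Φ := (hφ2 x₀ hx₀).trans_le (hφΦ x₀ hx₀)
  have hΨ : 0 < Ψ := (hψ2 x₀ hx₀).trans_le (hψΨ x₀ hx₀)
  set D := (Φ / M * N ^ (-(M / 2)) + Ψ) * (S.card : ℝ) with hDdef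
  have hD : 0 < D := by positivity
  rw [hlam2, lt_div_iff₀ hD] at hlt
  set K := Q / P * (2 : ℝ) ^ (-(P / 2)) * (B.card : ℝ) ^ (P / 2) * N ^ (1 - P) *
    N ^ (-(P / 2)) with hKdef
  have hbound : ∀ u : V → ℝ, (∀ x ∈ B, u x = 0) →
      Real.sqrt (∑ x, u x ^ 2) = N ^ (-(1 / 2) : ℝ) → K - lam * D ≤ J u := by
    intro u hu hnorm
    have hsq : ∑ x, u x ^ 2 = N⁻¹ := by
      rw [← Real.sq_sqrt (sum_nonneg fun x _ => sq_nonneg (u x)), hnorm, ← Real.rpow_natCast,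
        ← Real.rpow_mul hN.le, ← Real.rpow_neg_one]
      norm_num
    have hsqS : ∑ x ∈ S, u x ^ 2 = N⁻¹ := by
      rw [← hsq, ← hcover, sum_union hdisj, sum_eq_zero (s := B) fun x hx => by simp [hu x hx],
        add_zero]
    have habs : ∀ x, |u x| ≤ N ^ (-(1 / 2) : ℝ) := fun x => by
      rw [← hnorm]
      exact Real.abs_le_sqrt (single_le_sum (f := fun x => u x ^ 2)
        (fun i _ => sq_nonneg (u i)) (mem_univ x))
    have hr1 : N ^ (-(1 / 2) : ℝ) ≤ 1 :=
      Real.rpow_le_one_of_one_le_of_nonpos hN1 (by norm_num)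
    have hgrad : 0 ≤ (1 / 2) * ∑ x, (1 / p x) * ∑ y, |u y - u x| ^ (p x) * ω x y := by
      refine mul_nonneg (by norm_num) (sum_nonneg fun x _ => mul_nonneg ?_
        (sum_nonneg fun y _ => mul_nonneg (by positivity) (hnn x y)))
      exact one_div_nonneg.mpr (by linarith [hp x])
    have hpot : K ≤ ∑ x ∈ S, (1 / p x) * q x * |u x| ^ (p x) := by
      have hterm : ∀ x ∈ S, Q / P * |u x| ^ P ≤ (1 / p x) * q x * |u x| ^ (p x) := by
        intro x hx
        have hpx : 0 < p x := by linarith [hp x]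
        have h1 : Q / P ≤ (1 / p x) * q x := by
          rw [one_div, inv_mul_eq_div]
          exact div_le_div₀ (hq x hx).le (hQq x hx) hpx (hpP x hx)
        have h2 : |u x| ^ P ≤ |u x| ^ p x :=
          Real.rpow_le_rpow_of_exponent_ge_of_imp (abs_nonneg _) ((habs x).trans hr1) (hpP x hx)
            fun _ h => absurd h (by linarith)
        exact mul_le_mul h1 h2 (by positivity)
          (mul_nonneg (by positivity) (hq x hx).le)
      have hmean := rpow_mul_rpow_le_sum_abs_rpow S u hP hN hSN
      rw [hsqS, Real.inv_rpow hN.le, ← Real.rpow_neg hN.le] at hmean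
      have hconst := two_rpow_mul_rpow_le (show 0 ≤ P by linarith) (Nat.cast_nonneg B.card) hBN hN
      calc K = Q / P * (((2 : ℝ) ^ (-(P / 2)) * (B.card : ℝ) ^ (P / 2) * N ^ (1 - P)) *
              N ^ (-(P / 2))) := by rw [hKdef]; ring
        _ ≤ Q / P * (N ^ (1 - P / 2) * N ^ (-(P / 2))) := by gcongr
        _ ≤ Q / P * ∑ x ∈ S, |u x| ^ P := by gcongr
        _ ≤ _ := by rw [mul_sum]; exact sum_le_sum hterm
    have hnonlin : ∑ x ∈ S, ∫ s in (0:ℝ)..(max (u x) 0), f x s ≤ D := by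
      have hterm : ∀ x ∈ S, ∫ s in (0:ℝ)..(max (u x) 0), f x s ≤
          Φ / M * N ^ (-(M / 2)) + Ψ := by
        intro x hx
        have ht0 : 0 ≤ max (u x) 0 := le_max_right _ _
        have htr : max (u x) 0 ≤ N ^ (-(1 / 2) : ℝ) :=
          (max_le (le_abs_self _) (abs_nonneg _)).trans (habs x)
        have hmx : 2 ≤ m2 x := hm2 x hx
        refine (integral_le_of_le_rpow_add (hfc x hx) (by linarith) ht0
          fun s hs => (hf1 x hx s hs).2).trans ?_
        have h1 : φ2 x / m2 x ≤ Φ / M :=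
          div_le_div₀ hΦ.le (hφΦ x hx) (by linarith) (hMm x hx)
        have h2 : max (u x) 0 ^ m2 x ≤ N ^ (-(M / 2)) :=
          calc max (u x) 0 ^ m2 x ≤ (N ^ (-(1 / 2) : ℝ)) ^ m2 x :=
                Real.rpow_le_rpow ht0 htr (by linarith)
            _ = N ^ (-(m2 x / 2)) := by
                rw [← Real.rpow_mul hN.le]
                congr 1
                ring
            _ ≤ N ^ (-(M / 2)) :=
                Real.rpow_le_rpow_of_exponent_le hN1 (by linarith [hMm x hx])
        have h3 : ψ2 x * max (u x) 0 ≤ Ψ * 1 :=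
          mul_le_mul (hψΨ x hx) (htr.trans hr1) ht0 hΨ.le
        have h4 : φ2 x / m2 x * max (u x) 0 ^ m2 x ≤ Φ / M * N ^ (-(M / 2)) :=
          mul_le_mul h1 h2 (by positivity) (by positivity)
        linarith
      calc _ ≤ S.card • (Φ / M * N ^ (-(M / 2)) + Ψ) := sum_le_card_nsmul _ _ _ hterm
        _ = D := by rw [hDdef, nsmul_eq_mul, mul_comm]
    have := mul_le_mul_of_nonneg_left hnonlin hlam.le
    rw [hJ]
    linarith
  have hpos : 0 < K - lam * D := sub_pos.mpr hlt
  refine ⟨fun u hu hnorm => hpos.trans_le (hbound u hu hnorm),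
    hpos.trans_le (le_csInf (Set.Nonempty.image J ?_) ?_)⟩
  · refine ⟨Pi.single x₀ (N ^ (-(1 / 2) : ℝ)), fun x hx => ?_, ?_⟩
    · exact Pi.single_eq_of_ne (by rintro rfl; exact disjoint_left.mp hdisj hx₀ hx) _
    · rw [sum_eq_single x₀ (fun y _ hy => by simp [Pi.single_eq_of_ne hy]) (by simp),
        Pi.single_eq_same, Real.sqrt_sq (by positivity)]
  · rintro _ ⟨u, ⟨hu, hnorm⟩, rfl⟩
    exact hbound u hu hnorm
end

section
/- Assume condition (f.1) and p⁻ ≠ m₁⁺, where p⁻ = min_{x∈S} p(x) and m₁⁺ = max_{x∈S} m₁(x). Set λ₂ = [(q⁻/p⁺) · 2^{−p⁺/2} · |∂S|^{p⁺/2} · |S̄|^{1−p⁺} · |S̄|^{−p⁺/2}] / [((φ₂⁺/m₂⁻) · |S̄|^{−m₂⁻/2} + ψ₂⁺) · |S|]. Then for every λ ∈ (0, λ₂) the problem −Δ_{p(x),ω}u(x) + q(x)|u(x)|^{p(x)−2}u(x) = λ f(x, u(x)) on S, u = 0 on ∂S, has at least one positive solution. -/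
open Finset

/-- A system `F x u = 0`, `x ∈ S`, that is nonincreasing in the off-diagonal variables and for which
`0` is a strict subsolution has a positive solution below each supersolution `w ≥ 0`.
It is obtained as a supersolution in `[0, w]` of minimal total mass. -/
theorem exists_pos_solution_of_supersolution {V : Type*} [Fintype V] [DecidableEq V]
    (S : Finset V) (F : V → (V → ℝ) → ℝ) (w : V → ℝ)
    (hcont : ∀ x ∈ S, Continuous (F x))
    (hmono : ∀ x ∈ S, ∀ u v : V → ℝ, v ≤ u → v x = u x → F x u ≤ F x v)
    (hw : 0 ≤ w) (hwS : ∀ x ∉ S, w x = 0) (hsuper : ∀ x ∈ S, 0 ≤ F x w)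
    (hsub : ∀ x ∈ S, ∀ u : V → ℝ, 0 ≤ u → u x = 0 → F x u < 0) :
    ∃ u : V → ℝ, (∀ x ∉ S, u x = 0) ∧ (∀ x ∈ S, 0 < u x) ∧ ∀ x ∈ S, F x u = 0 := by
  have hK : IsCompact (Set.Icc 0 w ∩ ⋂ x ∈ S, {u | 0 ≤ F x u}) :=
    isCompact_Icc.inter_right <| isClosed_biInter fun x hx =>
      isClosed_le continuous_const (hcont x hx)
  obtain ⟨u, ⟨⟨hu0, huw⟩, huF⟩, hmin⟩ := hK.exists_isMinOn
    (f := fun u : V → ℝ => ∑ x, u x)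
    ⟨w, ⟨hw, le_rfl⟩, Set.mem_iInter₂.2 hsuper⟩ (by fun_prop)
  replace huF : ∀ x ∈ S, 0 ≤ F x u := Set.mem_iInter₂.1 huF
  have hpos : ∀ x ∈ S, 0 < u x := fun x hx =>
    (hu0 x).lt_of_ne fun h => (hsub x hx u hu0 h.symm).not_ge (huF x hx)
  refine ⟨u, fun x hx => le_antisymm ((huw x).trans_eq (hwS x hx)) (hu0 x), hpos, fun x hx => ?_⟩
  by_contra hne
  have hFx : 0 < F x u := (huF x hx).lt_of_ne' hne
  have hev : ∀ᶠ s in nhds (u x), 0 < s ∧ 0 < F x (Function.update u x s) := by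
    refine (lt_mem_nhds (hpos x hx)).and ?_
    have hc : Continuous fun s => F x (Function.update u x s) :=
      (hcont x hx).comp (continuous_const.update x continuous_id)
    exact hc.continuousAt.eventually (lt_mem_nhds (by simpa using hFx))
  obtain ⟨s, ⟨hs0, hFs⟩, hsx⟩ :=
    ((hev.filter_mono nhdsWithin_le_nhds).and (self_mem_nhdsWithin (s := Set.Iio (u x)))).exists
  replace hsx : s < u x := hsx
  have hle : Function.update u x s ≤ u := update_le_self_iff.2 hsx.le
  have hmem : Function.update u x s ∈ Set.Icc 0 w ∩ ⋂ x ∈ S, {u | 0 ≤ F x u} := by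
    refine ⟨⟨?_, hle.trans huw⟩, Set.mem_iInter₂.2 fun y hy => ?_⟩
    · exact le_update_iff.2 ⟨hs0.le, fun y _ => hu0 y⟩
    · rcases eq_or_ne y x with rfl | hyx
      · exact hFs.le
      · exact (huF y hy).trans (hmono y hy _ _ hle (Function.update_of_ne hyx _ _))
  refine (Finset.sum_lt_sum (fun y _ => hle y) ⟨x, mem_univ x, ?_⟩).not_ge (hmin hmem)
  simpa using hsx

/-- The scalar inequality making the constant `N ^ (-1/2) / 2` a supersolution. -/
theorem mul_add_le_mul_rpow_of_mul_lt {N b n P m q φ ψ lam : ℝ} (hN : 2 ≤ N) (hb : 0 ≤ b)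
    (hbN : b ≤ N) (hn : 1 ≤ n) (hP : 2 ≤ P) (hm : 2 ≤ m) (hq : 0 < q) (hφ : 0 < φ) (hψ : 0 < ψ)
    (hlam : 0 < lam)
    (hlt : lam < q / P * 2 ^ (-(P / 2)) * b ^ (P / 2) * N ^ (1 - P) * N ^ (-(P / 2)) /
      ((φ / m * N ^ (-(m / 2)) + ψ) * n)) :
    lam * (φ * (N ^ (-(1 / 2) : ℝ) / 2) ^ (m - 1) + ψ) ≤
      q * (N ^ (-(1 / 2) : ℝ) / 2) ^ (P - 1) := by
  have hN0 : 0 < N := by linarith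
  have hm0 : 0 < m := by linarith
  have hexp : ∀ r : ℝ, (N ^ (-(1 / 2) : ℝ) / 2) ^ (r - 1) =
      N ^ (1 / 2 : ℝ) * N ^ (-(r / 2)) * 2 ^ (1 - r) := fun r => by
    rw [Real.div_rpow (by positivity) zero_le_two, ← Real.rpow_mul hN0.le, ← Real.rpow_add hN0,
      div_eq_mul_inv, ← Real.rpow_neg zero_le_two]
    ring_nf
  have hbern : (2 : ℝ) ^ (1 - m) ≤ 1 / m := by
    have h := one_add_mul_self_le_rpow_one_add (s := 1) (by norm_num) (p := m - 1) (by linarith)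
    rw [show 1 - m = -(m - 1) by ring, Real.rpow_neg zero_le_two, ← one_div]
    apply one_div_le_one_div_of_le hm0
    norm_num at h
    exact h
  have hNhalf : 1 ≤ N ^ (1 / 2 : ℝ) := Real.one_le_rpow (by linarith) (by norm_num)
  have hD : 0 < φ / m * N ^ (-(m / 2)) + ψ := by positivity
  rw [lt_div_iff₀ (by positivity)] at hlt
  have hb1 : b ^ (P / 2) * N ^ (-(P / 2)) ≤ 1 := by
    rw [Real.rpow_neg hN0.le, ← div_eq_mul_inv, div_le_one (by positivity)]
    gcongr
  have hupper : q / P * 2 ^ (-(P / 2)) * b ^ (P / 2) * N ^ (1 - P) * N ^ (-(P / 2)) ≤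
      q * 2 ^ (-(P / 2)) * N ^ (1 - P) := by
    calc _ = q / P * 2 ^ (-(P / 2)) * N ^ (1 - P) * (b ^ (P / 2) * N ^ (-(P / 2))) := by ring
      _ ≤ q / 1 * 2 ^ (-(P / 2)) * N ^ (1 - P) * 1 := by gcongr; linarith
      _ = _ := by ring
  have hNP : N ^ (1 - P) * 2 ^ (-(P / 2)) ≤ N ^ (-(P / 2)) * 2 ^ (1 - P) := by
    have h : N ^ (1 - P / 2) ≤ 2 ^ (1 - P / 2) :=
      Real.rpow_le_rpow_of_nonpos two_pos hN (by linarith)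
    calc N ^ (1 - P) * 2 ^ (-(P / 2))
        = N ^ (1 - P / 2) * N ^ (-(P / 2)) * 2 ^ (-(P / 2)) := by
          rw [← Real.rpow_add hN0]; ring_nf
      _ ≤ 2 ^ (1 - P / 2) * N ^ (-(P / 2)) * 2 ^ (-(P / 2)) := by gcongr
      _ = N ^ (-(P / 2)) * (2 ^ (1 - P / 2) * 2 ^ (-(P / 2))) := by ring
      _ = _ := by rw [← Real.rpow_add two_pos]; ring_nf
  rw [hexp, hexp]
  calc lam * (φ * (N ^ (1 / 2 : ℝ) * N ^ (-(m / 2)) * 2 ^ (1 - m)) + ψ)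
      ≤ lam * (φ * (N ^ (1 / 2 : ℝ) * N ^ (-(m / 2)) * (1 / m)) + N ^ (1 / 2 : ℝ) * ψ) := by
        gcongr
        exact le_mul_of_one_le_left hψ.le hNhalf
    _ = N ^ (1 / 2 : ℝ) * (lam * ((φ / m * N ^ (-(m / 2)) + ψ) * 1)) := by ring
    _ ≤ N ^ (1 / 2 : ℝ) * (lam * ((φ / m * N ^ (-(m / 2)) + ψ) * n)) := by gcongr
    _ ≤ N ^ (1 / 2 : ℝ) * (q * 2 ^ (-(P / 2)) * N ^ (1 - P)) := by
        exact mul_le_mul_of_nonneg_left (hlt.le.trans hupper) (by positivity)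
    _ = N ^ (1 / 2 : ℝ) * q * (N ^ (1 - P) * 2 ^ (-(P / 2))) := by ring
    _ ≤ N ^ (1 / 2 : ℝ) * q * (N ^ (-(P / 2)) * 2 ^ (1 - P)) := by gcongr
    _ = _ := by ring

/-- Under condition (f.1) and `p⁻ ≠ m₁⁺`, for every `λ ∈ (0, λ₂)` the problem
`−Δ_{p(x),ω}u(x) + q(x)|u(x)|^{p(x)−2}u(x) = λ f(x,u(x))` on `S`, `u = 0` on
`∂S`, has at least one positive solution. -/
theorem stmt_17 {V : Type*} [Fintype V] [DecidableEq V]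
    (S B : Finset V) (hS : S.Nonempty) (hB : B.Nonempty)
    (hdisj : Disjoint S B) (hcover : S ∪ B = Finset.univ)
    (ω : V → V → ℝ) (hsym : ∀ x y, ω x y = ω y x) (hnn : ∀ x y, 0 ≤ ω x y)
    (p : V → ℝ) (hp : ∀ x, 2 ≤ p x)
    (q : V → ℝ) (hq : ∀ x ∈ S, 0 < q x)
    (f : V → ℝ → ℝ) (hfc : ∀ x ∈ S, Continuous (f x))
    -- condition (f.1)
    (m1 m2 φ1 φ2 ψ1 ψ2 : V → ℝ)
    (hm1 : ∀ x ∈ S, 2 ≤ m1 x) (hm2 : ∀ x ∈ S, 2 ≤ m2 x)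
    (hφ1 : ∀ x ∈ S, 0 < φ1 x) (hφ2 : ∀ x ∈ S, 0 < φ2 x)
    (hψ1 : ∀ x ∈ S, 0 < ψ1 x) (hψ2 : ∀ x ∈ S, 0 < ψ2 x)
    (hf1 : ∀ x ∈ S, ∀ t : ℝ, 0 ≤ t →
      ψ1 x + φ1 x * t ^ (m1 x - 1) ≤ f x t ∧ f x t ≤ φ2 x * t ^ (m2 x - 1) + ψ2 x)
    -- p⁻ ≠ m₁⁺
    (hne : S.inf' hS p ≠ S.sup' hS m1)
    -- λ₂
    (lam2 : ℝ)
    (hlam2 : lam2 =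
      (S.inf' hS q / S.sup' hS p) * (2 : ℝ) ^ (-(S.sup' hS p / 2)) *
          (B.card : ℝ) ^ (S.sup' hS p / 2) *
          (Fintype.card V : ℝ) ^ (1 - S.sup' hS p) *
          (Fintype.card V : ℝ) ^ (-(S.sup' hS p / 2)) /
        ((S.sup' hS φ2 / S.inf' hS m2 *
            (Fintype.card V : ℝ) ^ (-(S.inf' hS m2 / 2)) + S.sup' hS ψ2) *
          (S.card : ℝ)))
    (lam : ℝ) (hlam : 0 < lam) (hlt : lam < lam2) :
    ∃ u : V → ℝ, (∀ x ∈ B, u x = 0) ∧ (∀ x ∈ S, 0 < u x) ∧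
      ∀ x ∈ S,
        -(∑ y, |u y - u x| ^ (p x - 2) * (u y - u x) * ω x y)
          + q x * |u x| ^ (p x - 2) * u x = lam * f x (u x) := by
  have hr : ∀ x, 0 ≤ p x - 2 := fun x => by linarith [hp x]
  obtain ⟨x₀, hx₀⟩ := hS
  have hSB : S.card + B.card = Fintype.card V := by
    rw [← card_union_of_disjoint hdisj, hcover, card_univ]
  have hS1 : 1 ≤ S.card := card_pos.2 ⟨x₀, hx₀⟩
  have hB1 : 1 ≤ B.card := card_pos.2 hB
  have hN : (2 : ℝ) ≤ Fintype.card V := by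
    exact_mod_cast (by omega : 2 ≤ Fintype.card V)
  have hscalar := mul_add_le_mul_rpow_of_mul_lt hN (Nat.cast_nonneg B.card)
    (by exact_mod_cast (by omega : B.card ≤ Fintype.card V)) (by exact_mod_cast hS1)
    ((hp x₀).trans (le_sup' p hx₀)) ((le_inf'_iff _ _).2 hm2) ((lt_inf'_iff _).2 hq)
    ((hφ2 x₀ hx₀).trans_le (le_sup' φ2 hx₀)) ((hψ2 x₀ hx₀).trans_le (le_sup' ψ2 hx₀))
    hlam (hlam2 ▸ hlt)
  set c : ℝ := (Fintype.card V : ℝ) ^ (-(1 / 2) : ℝ) / 2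
  have hc : 0 < c := by positivity
  have hc1 : c ≤ 1 := by
    have : (Fintype.card V : ℝ) ^ (-(1 / 2) : ℝ) ≤ 1 :=
      Real.rpow_le_one_of_one_le_of_nonpos (by linarith) (by norm_num)
    simp only [c]
    linarith
  refine Exists.imp ?_ (exists_pos_solution_of_supersolution S
    (fun x u => -(∑ y, |u y - u x| ^ (p x - 2) * (u y - u x) * ω x y)
      + q x * |u x| ^ (p x - 2) * u x - lam * f x (u x))
    (fun x => if x ∈ S then c else 0) ?_ ?_ ?_ ?_ ?_ ?_)
  · rintro u ⟨huS, hupos, hu⟩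
    exact ⟨fun x hx => huS x (disjoint_right.1 hdisj hx), hupos,
      fun x hx => sub_eq_zero.1 (hu x hx)⟩
  · intro x hx
    have hpow : Continuous fun t : ℝ => |t| ^ (p x - 2) :=
      continuous_abs.rpow_const fun _ => Or.inr (hr x)
    have := hfc x hx
    have h1 : ∀ y, Continuous fun u : V → ℝ => |u y - u x| ^ (p x - 2) := fun y =>
      hpow.comp (by fun_prop)
    have h2 : Continuous fun u : V → ℝ => |u x| ^ (p x - 2) := hpow.comp (by fun_prop)
    fun_prop
  · intro x _ u v hvu hx
    simp only [hx]
    refine sub_le_sub_right (add_le_add_left (neg_le_neg (sum_le_sum fun y _ => ?_)) _) _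
    exact mul_le_mul_of_nonneg_right
      (monotone_abs_rpow_mul_self (hr x) (sub_le_sub_right (hvu y) _)) (hnn x y)
  · intro x
    dsimp only
    split_ifs <;> simp [hc.le]
  · intro x hx
    simp [hx]
  · intro x hx
    simp only [hx, if_true]
    have hsum : ∑ y, |(if y ∈ S then c else 0) - c| ^ (p x - 2) *
        ((if y ∈ S then c else 0) - c) * ω x y ≤ 0 := by
      refine sum_nonpos fun y _ => mul_nonpos_of_nonpos_of_nonneg
        (mul_nonpos_of_nonneg_of_nonpos (by positivity) ?_) (hnn x y)
      split_ifs <;> linarith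
    have hpow : |c| ^ (p x - 2) * c = c ^ (p x - 1) := by
      rw [abs_of_pos hc, ← Real.rpow_add_one hc.ne']
      ring_nf
    have hbound : lam * f x c ≤ q x * c ^ (p x - 1) := by
      have hφx := hφ2 x hx
      have hqx := hq x hx
      calc lam * f x c ≤ lam * (φ2 x * c ^ (m2 x - 1) + ψ2 x) := by
            gcongr
            exact (hf1 x hx c hc.le).2
        _ ≤ lam * (S.sup' ⟨x₀, hx₀⟩ φ2 * c ^ (S.inf' ⟨x₀, hx₀⟩ m2 - 1)
              + S.sup' ⟨x₀, hx₀⟩ ψ2) := by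
            have hφle := le_sup' φ2 hx
            have hψle := le_sup' ψ2 hx
            have hmle : c ^ (m2 x - 1) ≤ c ^ (S.inf' ⟨x₀, hx₀⟩ m2 - 1) :=
              Real.rpow_le_rpow_of_exponent_ge hc hc1 (by linarith [inf'_le m2 hx])
            have := hφx.le.trans hφle
            gcongr
        _ ≤ S.inf' ⟨x₀, hx₀⟩ q * c ^ (S.sup' ⟨x₀, hx₀⟩ p - 1) := hscalar
        _ ≤ q x * c ^ (p x - 1) := by
            have hple : c ^ (S.sup' ⟨x₀, hx₀⟩ p - 1) ≤ c ^ (p x - 1) :=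
              Real.rpow_le_rpow_of_exponent_ge hc hc1 (by linarith [le_sup' p hx])
            have hqle := inf'_le q hx
            gcongr
    rw [mul_assoc, hpow]
    linarith
  · intro x hx u hu hux
    have hsum : 0 ≤ ∑ y, |u y - u x| ^ (p x - 2) * (u y - u x) * ω x y := by
      refine sum_nonneg fun y _ => mul_nonneg (mul_nonneg (by positivity) ?_) (hnn x y)
      simpa [hux] using hu y
    have hf0 : 0 < f x (u x) := by
      have hφx := hφ1 x hx
      have hux0 := hu x
      have := Real.rpow_nonneg hux0 (m1 x - 1)
      exact (by have := hψ1 x hx; positivity : 0 < ψ1 x + φ1 x * u x ^ (m1 x - 1)).trans_le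
        (hf1 x hx (u x) hux0).1
    have : q x * |u x| ^ (p x - 2) * u x = 0 := by rw [hux, mul_zero]
    have := mul_pos hlam hf0
    linarith
end

section
/- Assume condition (f.1) and m₁⁻ > p̄⁺, where m₁⁻ = min_{x∈S} m₁(x) and p̄⁺ = max_{x∈S̄} p(x). Then the action functional J satisfies the Palais–Smale condition: every sequence (uₙ) in A such that (J(uₙ)) is bounded and ∇J(uₙ) → 0 (where ∇J(u) ∈ A is the gradient of J, i.e., ⟨∇J(u), v⟩ = (1/2) ∑_{x,y∈S̄} |u(y)−u(x)|^{p(x)−2}(u(y)−u(x))(v(y)−v(x)) ω(x,y) + ∑_{x∈S} q(x)|u(x)|^{p(x)−2}u(x)v(x) − λ ∑_{x∈S} f(x,u₊(x))v(x) for all v ∈ A) has a convergent subsequence. -/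
open Finset Filter

lemma rpow_abs_mul_sub_mul_negPart_sub_nonpos (r a b : ℝ) :
    |b - a| ^ r * (b - a) * (max (-b) 0 - max (-a) 0) ≤ 0 := by
  have h : (b - a) * (max (-b) 0 - max (-a) 0) ≤ 0 := by
    rcases le_total a b with hab | hab
    · exact mul_nonpos_of_nonneg_of_nonpos (sub_nonneg.2 hab)
        (sub_nonpos.2 (max_le_max_right 0 (neg_le_neg hab)))
    · exact mul_nonpos_of_nonpos_of_nonneg (sub_nonpos.2 hab)
        (sub_nonneg.2 (max_le_max_right 0 (neg_le_neg hab)))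
  rw [mul_assoc]
  exact mul_nonpos_of_nonneg_of_nonpos (Real.rpow_nonneg (abs_nonneg _) _) h

lemma rpow_abs_mul_self_mul_negPart {p : ℝ} (hp : 2 ≤ p) (a : ℝ) :
    |a| ^ (p - 2) * a * max (-a) 0 = -(max (-a) 0) ^ p := by
  rcases le_or_gt 0 a with ha | ha
  · rw [max_eq_right (neg_nonpos.2 ha), Real.zero_rpow (by linarith)]
    simp
  · rw [max_eq_left (by linarith), abs_of_neg ha]
    have h : (-a) ^ p = (-a) ^ (p - 2) * (-a) ^ (2 : ℝ) := by
      rw [← Real.rpow_add (by linarith)]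
      ring_nf
    rw [h, Real.rpow_two]
    ring

/-- Testing the derivative with the negative part of `u` controls the zeroth-order term. -/
lemma sum_mul_negPart_rpow_le {V : Type*} [Fintype V] (S : Finset V) {ω : V → V → ℝ}
    (hnn : ∀ x y, 0 ≤ ω x y) {p q : V → ℝ} (hp : ∀ x, 2 ≤ p x) {lam : ℝ} (hlam : 0 < lam)
    {f : V → ℝ → ℝ} (hf0 : ∀ x ∈ S, 0 ≤ f x 0) (u : V → ℝ) :
    ∑ x ∈ S, q x * max (-u x) 0 ^ p x ≤
      -((1 / 2) * ∑ x, ∑ y, |u y - u x| ^ (p x - 2) * (u y - u x) *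
            (max (-u y) 0 - max (-u x) 0) * ω x y
        + ∑ x ∈ S, q x * |u x| ^ (p x - 2) * u x * max (-u x) 0
        - lam * ∑ x ∈ S, f x (max (u x) 0) * max (-u x) 0) := by
  have h1 : ∑ x, ∑ y, |u y - u x| ^ (p x - 2) * (u y - u x) *
      (max (-u y) 0 - max (-u x) 0) * ω x y ≤ 0 :=
    Finset.sum_nonpos fun x _ => Finset.sum_nonpos fun y _ =>
      mul_nonpos_of_nonpos_of_nonneg
        (rpow_abs_mul_sub_mul_negPart_sub_nonpos _ _ _) (hnn x y)
  have h2 : ∑ x ∈ S, q x * |u x| ^ (p x - 2) * u x * max (-u x) 0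
      = -∑ x ∈ S, q x * max (-u x) 0 ^ p x := by
    rw [← Finset.sum_neg_distrib]
    refine Finset.sum_congr rfl fun x _ => ?_
    linear_combination q x * rpow_abs_mul_self_mul_negPart (hp x) (u x)
  have h3 : 0 ≤ ∑ x ∈ S, f x (max (u x) 0) * max (-u x) 0 := by
    refine Finset.sum_nonneg fun x hx => ?_
    rcases le_total 0 (u x) with h | h
    · rw [max_eq_right (neg_nonpos.2 h), mul_zero]
    · rw [max_eq_right h]
      exact mul_nonneg (hf0 x hx) (le_max_right _ _)
  nlinarith [mul_nonneg hlam.le h3]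

/-- A superlinear quantity dominated by the Euclidean norm forces boundedness. -/
lemma exists_bound_of_sum_mul_rpow_le_sqrt {V : Type*} [Fintype V] [Nonempty V] (S : Finset V)
    {p q : V → ℝ} (hp : ∀ x, 2 ≤ p x) (hq : ∀ x ∈ S, 0 < q x) :
    ∃ K : ℝ, ∀ a : V → ℝ, (∀ x, 0 ≤ a x) → (∀ x ∉ S, a x = 0) →
      ∑ x ∈ S, q x * a x ^ p x ≤ √(∑ x, a x ^ 2) → ∀ x, a x ≤ K := by
  set N := √(Fintype.card V : ℝ)
  have hN : 0 ≤ N := Real.sqrt_nonneg _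
  have hNq : ∀ x ∈ S, 0 ≤ N / q x := fun x hx => div_nonneg hN (hq x hx).le
  refine ⟨1 + ∑ x ∈ S, N / q x, fun a ha haS h x => ?_⟩
  obtain ⟨z, hz⟩ := Finite.exists_max a
  refine (hz x).trans ?_
  have hsum := Finset.sum_nonneg hNq
  rcases le_or_gt (a z) 1 with h1 | h1
  · linarith
  have hzS : z ∈ S := by
    by_contra hzS
    linarith [haS z hzS]
  have hsqrt : √(∑ x, a x ^ 2) ≤ N * a z := by
    rw [← Real.sqrt_sq (ha z), ← Real.sqrt_mul (Nat.cast_nonneg _)]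
    refine Real.sqrt_le_sqrt ?_
    calc ∑ x, a x ^ 2 ≤ ∑ _x : V, a z ^ 2 :=
          Finset.sum_le_sum fun y _ => pow_le_pow_left₀ (ha y) (hz y) 2
      _ = _ := by simp
  have hterm : q z * a z ^ p z ≤ ∑ x ∈ S, q x * a x ^ p x :=
    Finset.single_le_sum (f := fun x => q x * a x ^ p x)
      (fun y hy => mul_nonneg (hq y hy).le (Real.rpow_nonneg (ha y) _)) hzS
  have hpow : a z ^ 2 ≤ a z ^ p z := by
    rw [← Real.rpow_two]
    exact Real.rpow_le_rpow_of_exponent_le h1.le (hp z)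
  have hle : a z ≤ N / q z := by
    rw [le_div_iff₀ (hq z hzS)]
    have h5 := mul_le_mul_of_nonneg_left hpow (hq z hzS).le
    have h6 : (a z * q z) * a z ≤ N * a z := by linarith
    exact le_of_mul_le_mul_right h6 (by linarith)
  linarith [Finset.single_le_sum hNq hzS]

/-- The differential part of the action functional grows at most like the largest exponent. -/
lemma exists_energy_le_mul_rpow {V : Type*} [Fintype V] (S : Finset V) {ω : V → V → ℝ}
    (hnn : ∀ x y, 0 ≤ ω x y) {p q : V → ℝ} (hp : ∀ x, 2 ≤ p x) (hq : ∀ x ∈ S, 0 < q x)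
    {P : ℝ} (hP : ∀ x, p x ≤ P) :
    ∃ C : ℝ, ∀ (u : V → ℝ) (T : ℝ), 1 ≤ T → (∀ x, |u x| ≤ T) →
      (1 / 2) * ∑ x, (1 / p x) * ∑ y, |u y - u x| ^ (p x) * ω x y
        + ∑ x ∈ S, (1 / p x) * q x * |u x| ^ (p x) ≤ C * T ^ P := by
  refine ⟨(1 / 2) * ∑ x, (1 / p x) * ∑ y, 2 ^ p x * ω x y + ∑ x ∈ S, (1 / p x) * q x,
    fun u T hT hu => ?_⟩
  have hT0 : 0 ≤ T := by linarith
  have hp0 : ∀ x, 0 ≤ 1 / p x := fun x => one_div_nonneg.2 (by linarith [hp x])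
  have hTP : ∀ x, T ^ p x ≤ T ^ P := fun x => Real.rpow_le_rpow_of_exponent_le hT (hP x)
  rw [add_mul, mul_assoc, Finset.sum_mul, Finset.sum_mul]
  refine add_le_add (mul_le_mul_of_nonneg_left (Finset.sum_le_sum fun x _ => ?_) (by norm_num))
    (Finset.sum_le_sum fun x hx => mul_le_mul_of_nonneg_left ?_ (mul_nonneg (hp0 x) (hq x hx).le))
  · rw [mul_assoc, Finset.sum_mul]
    refine mul_le_mul_of_nonneg_left (Finset.sum_le_sum fun y _ => ?_) (hp0 x)
    have h1 : |u y - u x| ≤ 2 * T := (abs_sub _ _).trans (by linarith [hu x, hu y])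
    have h2 : |u y - u x| ^ p x ≤ 2 ^ p x * T ^ P := by
      calc |u y - u x| ^ p x ≤ (2 * T) ^ p x :=
            Real.rpow_le_rpow (abs_nonneg _) h1 (by linarith [hp x])
        _ = 2 ^ p x * T ^ p x := Real.mul_rpow (by norm_num) hT0
        _ ≤ 2 ^ p x * T ^ P := mul_le_mul_of_nonneg_left (hTP x) (by positivity)
    calc _ ≤ 2 ^ p x * T ^ P * ω x y := mul_le_mul_of_nonneg_right h2 (hnn x y)
      _ = _ := by ring
  · exact (Real.rpow_le_rpow (abs_nonneg _) (hu x) (by linarith [hp x])).trans (hTP x)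

lemma mul_rpow_div_le_integral {g : ℝ → ℝ} (hg : Continuous g) {m φ : ℝ} (hm : 2 ≤ m)
    (hle : ∀ t, 0 ≤ t → φ * t ^ (m - 1) ≤ g t) {T : ℝ} (hT : 0 ≤ T) :
    φ * (T ^ m / m) ≤ ∫ s in (0:ℝ)..T, g s := by
  have hint : ∫ s in (0:ℝ)..T, φ * s ^ (m - 1) = φ * (T ^ m / m) := by
    rw [intervalIntegral.integral_const_mul, integral_rpow (Or.inl (by linarith)),
      sub_add_cancel, Real.zero_rpow (by linarith), sub_zero]
  rw [← hint]
  refine intervalIntegral.integral_mono_on hT ?_ (hg.intervalIntegrable _ _)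
    fun t ht => hle t ht.1
  exact (intervalIntegral.intervalIntegrable_rpow' (by linarith)).const_mul φ

lemma le_rpow_inv_of_mul_rpow_le {c C P M m T : ℝ} (hc : 0 < c) (hPM : P < M) (hMm : M ≤ m)
    (hT : 1 ≤ T) (h : c * T ^ m ≤ C * T ^ P) : T ≤ (C / c) ^ (M - P)⁻¹ := by
  have hT0 : 0 < T := by linarith
  have h1 : T ^ (M - P) ≤ C / c := by
    rw [Real.rpow_sub hT0, div_le_div_iff₀ (Real.rpow_pos_of_pos hT0 _) hc]
    have h2 := mul_le_mul_of_nonneg_left (Real.rpow_le_rpow_of_exponent_le hT hMm) hc.le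
    linarith
  calc T = (T ^ (M - P)) ^ (M - P)⁻¹ := (Real.rpow_rpow_inv hT0.le (by linarith)).symm
    _ ≤ _ := Real.rpow_le_rpow (Real.rpow_nonneg hT0.le _) h1 (inv_nonneg.2 (by linarith))

/-- Under condition (f.1) and `m₁⁻ > p̄⁺`, the action functional `J` satisfies
the Palais–Smale condition: every sequence `(uₙ) ⊂ A` with `(J(uₙ))` bounded
and `∇J(uₙ) → 0` (i.e. `|⟨J'(uₙ), v⟩| ≤ εₙ ‖v‖` for all `v ∈ A` with
`εₙ → 0`) has a convergent subsequence. -/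
theorem stmt_18 {V : Type*} [Fintype V] [DecidableEq V] [Nonempty V]
    (S B : Finset V) (hS : S.Nonempty) (hB : B.Nonempty)
    (hdisj : Disjoint S B) (hcover : S ∪ B = Finset.univ)
    (ω : V → V → ℝ) (hsym : ∀ x y, ω x y = ω y x) (hnn : ∀ x y, 0 ≤ ω x y)
    (p : V → ℝ) (hp : ∀ x, 2 ≤ p x)
    (q : V → ℝ) (hq : ∀ x ∈ S, 0 < q x)
    (lam : ℝ) (hlam : 0 < lam)
    (f : V → ℝ → ℝ) (hfc : ∀ x ∈ S, Continuous (f x))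
    -- condition (f.1)
    (m1 m2 φ1 φ2 ψ1 ψ2 : V → ℝ)
    (hm1 : ∀ x ∈ S, 2 ≤ m1 x) (hm2 : ∀ x ∈ S, 2 ≤ m2 x)
    (hφ1 : ∀ x ∈ S, 0 < φ1 x) (hφ2 : ∀ x ∈ S, 0 < φ2 x)
    (hψ1 : ∀ x ∈ S, 0 < ψ1 x) (hψ2 : ∀ x ∈ S, 0 < ψ2 x)
    (hf1 : ∀ x ∈ S, ∀ t : ℝ, 0 ≤ t →
      ψ1 x + φ1 x * t ^ (m1 x - 1) ≤ f x t ∧ f x t ≤ φ2 x * t ^ (m2 x - 1) + ψ2 x)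
    -- m₁⁻ > p̄⁺
    (hm1p : Finset.univ.sup' Finset.univ_nonempty p < S.inf' hS m1)
    -- the action functional and its derivative pairing
    (J : (V → ℝ) → ℝ)
    (hJ : ∀ u : V → ℝ, J u =
      (1 / 2) * ∑ x, (1 / p x) * ∑ y, |u y - u x| ^ (p x) * ω x y
        + ∑ x ∈ S, (1 / p x) * q x * |u x| ^ (p x)
        - lam * ∑ x ∈ S, ∫ s in (0:ℝ)..(max (u x) 0), f x s)
    (DJ : (V → ℝ) → (V → ℝ) → ℝ)
    (hDJ : ∀ u v : V → ℝ, DJ u v =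
      (1 / 2) * ∑ x, ∑ y,
          |u y - u x| ^ (p x - 2) * (u y - u x) * (v y - v x) * ω x y
        + ∑ x ∈ S, q x * |u x| ^ (p x - 2) * u x * v x
        - lam * ∑ x ∈ S, f x (max (u x) 0) * v x) :
    -- Palais–Smale condition
    ∀ useq : ℕ → V → ℝ,
      (∀ n, ∀ x ∈ B, useq n x = 0) →
      (∃ C : ℝ, ∀ n, |J (useq n)| ≤ C) →
      (∀ ε > (0:ℝ), ∃ N : ℕ, ∀ n ≥ N, ∀ v : V → ℝ, (∀ x ∈ B, v x = 0) →
        |DJ (useq n) v| ≤ ε * Real.sqrt (∑ x, v x ^ 2)) →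
      ∃ φ : ℕ → ℕ, StrictMono φ ∧
        ∃ w : V → ℝ, Tendsto (fun n => useq (φ n)) atTop (nhds w) := by
  intro useq hB0 ⟨C₀, hC₀⟩ hgrad
  set P := Finset.univ.sup' Finset.univ_nonempty p
  set M := S.inf' hS m1
  have hP : ∀ x, p x ≤ P := fun x => Finset.le_sup' p (Finset.mem_univ x)
  have hM : ∀ x ∈ S, M ≤ m1 x := fun x hx => Finset.inf'_le m1 hx
  have hnS : ∀ x ∉ S, x ∈ B := fun x hx =>
    (Finset.mem_union.1 (hcover ▸ Finset.mem_univ x)).resolve_left hx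
  have hflow : ∀ x ∈ S, ∀ t, 0 ≤ t → φ1 x * t ^ (m1 x - 1) ≤ f x t := fun x hx t ht => by
    linarith [(hf1 x hx t ht).1, hψ1 x hx]
  have hf0 : ∀ x ∈ S, 0 ≤ f x 0 := fun x hx =>
    (mul_nonneg (hφ1 x hx).le (Real.rpow_nonneg le_rfl _)).trans (hflow x hx 0 le_rfl)
  obtain ⟨K, hK⟩ := exists_bound_of_sum_mul_rpow_le_sqrt S hp hq
  obtain ⟨C, hC⟩ := exists_energy_le_mul_rpow S hnn hp hq hP
  obtain ⟨N, hN⟩ := hgrad 1 one_pos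
  have hneg : ∀ n ≥ N, ∀ x, -useq n x ≤ K := by
    intro n hn x
    have hv0 : ∀ y ∈ B, max (-useq n y) 0 = 0 := fun y hy => by simp [hB0 n y hy]
    have h := hN n hn (fun y => max (-useq n y) 0) hv0
    rw [hDJ, one_mul] at h
    refine (le_max_left _ _).trans (hK (fun y => max (-useq n y) 0)
      (fun y => le_max_right _ _) (fun y hy => hv0 y (hnS y hy)) ?_ x)
    exact (sum_mul_negPart_rpow_le S hnn hp hlam hf0 (useq n)).trans
      ((neg_le_abs _).trans h)
  set c : V → ℝ := fun x => lam * φ1 x / m1 x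
  have hc : ∀ x ∈ S, 0 < c x := fun x hx =>
    div_pos (mul_pos hlam (hφ1 x hx)) (by linarith [hm1 x hx])
  set R : V → ℝ := fun x => |((C + C₀) / c x) ^ (M - P)⁻¹|
  have hbound : ∀ n ≥ N, ∀ x, |useq n x| ≤ 1 + |K| + ∑ z, R z := by
    intro n hn x
    obtain ⟨z, hz⟩ := Finite.exists_max fun x => |useq n x|
    refine (hz x).trans ?_
    have hR : ∀ x ∈ Finset.univ, 0 ≤ R x := fun x _ => abs_nonneg _
    rcases le_or_gt |useq n z| (1 + |K|) with hle | hgt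
    · linarith [Finset.sum_nonneg hR]
    have hpos : 0 < useq n z := by
      by_contra hcon
      rw [abs_of_nonpos (not_lt.1 hcon)] at hgt
      linarith [hneg n hn z, le_abs_self K]
    have hzS : z ∈ S := by
      by_contra hzS
      rw [hB0 n z (hnS z hzS)] at hpos
      exact lt_irrefl _ hpos
    rw [abs_of_pos hpos] at hgt hz ⊢
    set T := useq n z
    have hT : 1 ≤ T := by linarith [abs_nonneg K]
    have hint : φ1 z * (T ^ m1 z / m1 z)
        ≤ ∑ x ∈ S, ∫ s in (0:ℝ)..(max (useq n x) 0), f x s := by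
      have hF : ∀ x ∈ S, φ1 x * (max (useq n x) 0 ^ m1 x / m1 x)
          ≤ ∫ s in (0:ℝ)..(max (useq n x) 0), f x s := fun x hx =>
        mul_rpow_div_le_integral (hfc x hx) (hm1 x hx) (hflow x hx) (le_max_right _ _)
      have hzF := hF z hzS
      rw [max_eq_left hpos.le] at hzF
      refine hzF.trans ?_
      have hs := Finset.single_le_sum
        (f := fun x => ∫ s in (0:ℝ)..(max (useq n x) 0), f x s)
        (fun x hx => le_trans (mul_nonneg (hφ1 x hx).le (div_nonneg
          (Real.rpow_nonneg (le_max_right _ _) _) (by linarith [hm1 x hx]))) (hF x hx)) hzS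
      rwa [max_eq_left hpos.le] at hs
    have hen := hC (useq n) T hT hz
    have hJn := (abs_le.1 (hC₀ n)).1
    rw [hJ] at hJn
    have hC₀' : C₀ ≤ C₀ * T ^ P :=
      le_mul_of_one_le_right ((abs_nonneg _).trans (hC₀ n))
        (Real.one_le_rpow hT (by linarith [hp z, hP z]))
    have hkey : c z * T ^ m1 z ≤ (C + C₀) * T ^ P := by
      have h1 := mul_le_mul_of_nonneg_left hint hlam.le
      have h2 : c z * T ^ m1 z = lam * (φ1 z * (T ^ m1 z / m1 z)) := by
        simp only [c]
        ring
      linarith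
    have hTR : T ≤ R z :=
      (le_rpow_inv_of_mul_rpow_le (hc z hzS) hm1p (hM z hzS) hT hkey).trans (le_abs_self _)
    linarith [Finset.single_le_sum hR (Finset.mem_univ z), abs_nonneg K]
  have hmem : ∀ n ≥ N, useq n ∈ Metric.closedBall (0 : V → ℝ) (1 + |K| + ∑ z, R z) := by
    intro n hn
    rw [mem_closedBall_zero_iff, pi_norm_le_iff_of_nonneg
      ((abs_nonneg _).trans (hbound n hn (Classical.arbitrary V)))]
    exact hbound n hn
  obtain ⟨w, -, φ, hφ, hw⟩ := tendsto_subseq_of_frequently_bounded Metric.isBounded_closedBall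
    (eventually_atTop.2 ⟨N, hmem⟩).frequently
  exact ⟨φ, hφ, w, hw⟩
end

section
/- Assume condition (f.1) and m₁⁻ > p̄⁺, where m₁⁻ = min_{x∈S} m₁(x) and p̄⁺ = max_{x∈S̄} p(x). Set λ₂ = [(q⁻/p⁺) · 2^{−p⁺/2} · |∂S|^{p⁺/2} · |S̄|^{1−p⁺} · |S̄|^{−p⁺/2}] / [((φ₂⁺/m₂⁻) · |S̄|^{−m₂⁻/2} + ψ₂⁺) · |S|]. Then for every λ ∈ (0, λ₂) the problem −Δ_{p(x),ω}u(x) + q(x)|u(x)|^{p(x)−2}u(x) = λ f(x, u(x)) on S, u = 0 on ∂S, has at least two distinct positive solutions. -/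
open Finset

/-- A finite set `T` is dominant for a family of rankings `r` when no point ranks strictly above the
minimum of `T` in every ranking. -/
def Dominant {Z I α : Type*} [LinearOrder α] (r : I → Z → α) (T : Finset Z) : Prop :=
  ∀ y, ∃ i, ∀ x ∈ T, r i y ≤ r i x

theorem Dominant.mono {Z I α : Type*} [LinearOrder α] {r : I → Z → α} {P T : Finset Z}
    (h : P ⊆ T) (hT : Dominant r T) : Dominant r P := fun y => (hT y).imp fun _ hi x hx => hi x (h hx)

section Scarf

variable {Z I α : Type*} [DecidableEq Z] [Fintype I] [DecidableEq I] [LinearOrder α]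

/-- The structure of a nonempty dominant set with one element fewer than the number of rankings:
each ranking has a minimiser, exactly two rankings share one, and the dominant one-point extensions
are the maximal elements of the regions cut out by all rankings but one of these two. -/
theorem exists_extension_indices {r : I → Z → α} (hr : ∀ i, Function.Injective (r i))
    {P : Finset Z} (hP : P.Nonempty) (hcard : P.card + 1 = Fintype.card I) (hD : Dominant r P) :
    ∃ (m : I → Z) (a b : I), (∀ i, m i ∈ P) ∧ (∀ i, ∀ x ∈ P, r i (m i) ≤ r i x) ∧ a ≠ b ∧
      m a = m b ∧ ∀ y, (y ∉ P ∧ Dominant r (insert y P)) ↔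
        ∃ i, (i = a ∨ i = b) ∧ (∀ j, j ≠ i → r j (m j) < r j y) ∧
          ∀ y', (∀ j, j ≠ i → r j (m j) < r j y') → r i y' ≤ r i y := by
  have hmin : ∀ i, ∃ z ∈ P, ∀ x ∈ P, r i z ≤ r i x := fun i => P.exists_min_image (r i) hP
  choose m hmP hm using hmin
  have heq : ∀ i, ∀ x ∈ P, (∀ z ∈ P, r i x ≤ r i z) → m i = x := fun i x hx h =>
    hr i (le_antisymm (hm i x hx) (h _ (hmP i)))
  have hsurj : ∀ x ∈ P, ∃ i, m i = x := fun x hx => by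
    obtain ⟨i, hi⟩ := hD x
    exact ⟨i, heq i x hx hi⟩
  have hinj : ∀ i, P ⊆ (univ.erase i).image m → Set.InjOn m (univ.erase i : Finset I) := by
    intro i h
    apply Finset.injOn_of_card_image_eq
    apply le_antisymm card_image_le
    have h1 := card_le_card h
    have h2 : (univ.erase i : Finset I).card = Fintype.card I - 1 := by
      rw [card_erase_of_mem (mem_univ i), card_univ]
    omega
  obtain ⟨a, -, b, -, hab, hmab⟩ : ∃ a ∈ (univ : Finset I), ∃ b ∈ univ, a ≠ b ∧ m a = m b :=
    exists_ne_map_eq_of_card_lt_of_maps_to (t := P) (by rw [card_univ]; omega)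
      (fun i _ => hmP i)
  refine ⟨m, a, b, hmP, hm, hab, hmab, fun y => ⟨?_, ?_⟩⟩
  · rintro ⟨hy, hyD⟩
    obtain ⟨i, hi⟩ := hyD y
    have hlt : ∀ x ∈ P, ∃ j, j ≠ i ∧ m j = x ∧ r j (m j) < r j y := by
      intro x hx
      obtain ⟨j, hj⟩ := hyD x
      have hxy : x ≠ y := fun h => hy (h ▸ hx)
      have hmj : m j = x := heq j x hx fun z hz => hj z (mem_insert_of_mem hz)
      have hjy : r j x < r j y :=
        lt_of_le_of_ne (hj y (mem_insert_self _ _)) fun h => hxy (hr j h)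
      refine ⟨j, ?_, hmj, hmj ▸ hjy⟩
      rintro rfl
      exact absurd (hi x (mem_insert_of_mem hx)) (not_le.2 hjy)
    have hsub : P ⊆ (univ.erase i).image m := by
      intro x hx
      obtain ⟨j, hji, hmj, -⟩ := hlt x hx
      exact mem_image.2 ⟨j, by simp [hji], hmj⟩
    have hinji := hinj i hsub
    have hY : ∀ j, j ≠ i → r j (m j) < r j y := by
      intro j hj
      obtain ⟨k, hki, hmk, hk⟩ := hlt (m j) (hmP j)
      have : k = j := hinji (by simp [hki]) (by simp [hj]) hmk
      exact this ▸ hk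
    refine ⟨i, ?_, hY, ?_⟩
    · by_contra! hne
      exact hab (hinji (by simp [hne.1.symm]) (by simp [hne.2.symm]) hmab)
    · intro y' hy'
      obtain ⟨j, hj⟩ := hyD y'
      by_cases hji : j = i
      · exact hji ▸ hj y (mem_insert_self _ _)
      · exact absurd (hj (m j) (mem_insert_of_mem (hmP j))) (not_le.2 (hy' j hji))
  · rintro ⟨i, hi, hy, hmax⟩
    obtain ⟨k, hki, hmk⟩ : ∃ k, k ≠ i ∧ m k = m i := by
      rcases hi with rfl | rfl
      · exact ⟨b, hab.symm, hmab.symm⟩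
      · exact ⟨a, hab, hmab⟩
    refine ⟨fun hyP => ?_, fun y' => ?_⟩
    · obtain ⟨j, hj⟩ := hsurj y hyP
      by_cases hji : j = i
      · have := hy k hki
        rw [hmk, ← hji, hj] at this
        exact lt_irrefl _ this
      · have := hy j hji
        rw [hj] at this
        exact lt_irrefl _ this
    · by_cases hy' : ∀ j, j ≠ i → r j (m j) < r j y'
      · refine ⟨i, fun x hx => ?_⟩
        rcases mem_insert.1 hx with rfl | hx
        · exact hmax y' hy'
        · obtain ⟨j, hj⟩ := hD y'
          by_cases hji : j = i
          · exact hji ▸ hj x hx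
          · exact absurd (hj (m j) (hmP j)) (not_le.2 (hy' j hji))
      · push Not at hy'
        obtain ⟨j, hji, hj⟩ := hy'
        refine ⟨j, fun x hx => ?_⟩
        rcases mem_insert.1 hx with rfl | hx
        · exact hj.trans (hy j hji).le
        · exact hj.trans (hm j x hx)

/-- Away from the slack faces, the number of dominant one-point extensions is even. -/
theorem even_card_extensions [Fintype Z] {r : I → Z → α} (hr : ∀ i, Function.Injective (r i))
    {slack : I → Z} (hslack : Function.Injective slack) (hlow : ∀ i z, r i (slack i) ≤ r i z)
    (hhigh : ∀ i j, i ≠ j → ∀ z, z ∉ Set.range slack → r i z < r i (slack j))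
    {P : Finset Z} (hP : P.Nonempty) (hcard : P.card + 1 = Fintype.card I)
    (hne : ∀ i, P ≠ (univ.erase i).image slack)
    [DecidablePred fun y => y ∉ P ∧ Dominant r (insert y P)] :
    Even (univ.filter fun y => y ∉ P ∧ Dominant r (insert y P)).card := by
  rcases (univ.filter fun y => y ∉ P ∧ Dominant r (insert y P)).eq_empty_or_nonempty with h | ⟨y₀, h⟩
  · simp [h]
  have hD : Dominant r P := (mem_filter.1 h).2.2.mono (subset_insert _ _)
  obtain ⟨m, a, b, hmP, hm, hab, hmab, hE⟩ := exists_extension_indices hr hP hcard hD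
  have hYne : ∀ i j, j ≠ i → r j (m j) < r j (slack i) := by
    intro i j hji
    by_cases hmj : m j ∈ Set.range slack
    · obtain ⟨k, hk⟩ := hmj
      by_cases hkj : k = j
      · rw [← hk, hkj]
        exact lt_of_le_of_ne (hlow j _) fun h => hji (hslack (hr j h))
      · exfalso
        apply hne j
        apply eq_of_subset_of_card_le
        · intro x hx
          have hxr : x ∈ Set.range slack := by
            by_contra hxr
            exact absurd (hm j x hx) (not_le.2 (hk ▸ hhigh j k (Ne.symm hkj) x hxr))
          obtain ⟨l, rfl⟩ := hxr
          refine mem_image.2 ⟨l, ?_, rfl⟩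
          simp only [mem_erase, mem_univ, and_true]
          rintro rfl
          exact hkj (hslack (hk.trans (hr l (le_antisymm (hm l _ hx) (hlow l _)))))
        · rw [card_image_of_injective _ hslack, card_erase_of_mem (mem_univ j), card_univ]
          omega
    · exact hhigh j i hji _ hmj
  have hmax : ∀ i, ∃ y, (∀ j, j ≠ i → r j (m j) < r j y) ∧
      ∀ y', (∀ j, j ≠ i → r j (m j) < r j y') → r i y' ≤ r i y := by
    intro i
    classical
    obtain ⟨y, hy, hy'⟩ := (univ.filter fun y => ∀ j, j ≠ i → r j (m j) < r j y).exists_max_image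
      (r i) ⟨slack i, by simpa using hYne i⟩
    exact ⟨y, (mem_filter.1 hy).2, fun y' h => hy' y' (mem_filter.2 ⟨mem_univ _, h⟩)⟩
  choose y hy hymax using hmax
  have huniq : ∀ i z, ((∀ j, j ≠ i → r j (m j) < r j z) ∧
      ∀ y', (∀ j, j ≠ i → r j (m j) < r j y') → r i y' ≤ r i z) ↔ z = y i := fun i z =>
    ⟨fun h => hr i (le_antisymm (hymax i z h.1) (h.2 _ (hy i))), fun h => h ▸ ⟨hy i, hymax i⟩⟩
  have hyab : y a ≠ y b := by
    intro hEq
    have h1 : ∀ j, r j (m j) < r j (y a) := fun j => by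
      by_cases hj : j = a
      · rw [hEq]; exact hy b j (hj ▸ hab)
      · exact hy a j hj
    obtain ⟨j, hj⟩ := hD (y a)
    exact absurd (hj _ (hmP j)) (not_le.2 (h1 j))
  have : (univ.filter fun z => z ∉ P ∧ Dominant r (insert z P)) = {y a, y b} := by
    ext z
    simp only [mem_filter, mem_univ, true_and, hE, huniq, mem_insert, mem_singleton]
    grind
  rw [this, card_pair hyab]
  exact even_two

/-- A slack face has exactly one dominant one-point extension. -/
theorem card_extensions_slack [Fintype Z] {r : I → Z → α} (hr : ∀ i, Function.Injective (r i))
    {slack : I → Z} (hslack : Function.Injective slack) (hlow : ∀ i z, r i (slack i) ≤ r i z)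
    (hhigh : ∀ i j, i ≠ j → ∀ z, z ∉ Set.range slack → r i z < r i (slack j))
    (hreal : ∃ z, z ∉ Set.range slack) [Nontrivial I] (i₀ : I)
    {P : Finset Z} (hP : P = (univ.erase i₀).image slack)
    [DecidablePred fun y => y ∉ P ∧ Dominant r (insert y P)] :
    (univ.filter fun y => y ∉ P ∧ Dominant r (insert y P)).card = 1 := by
  have hmem : ∀ k, k ≠ i₀ → slack k ∈ P := fun k hk => hP ▸ mem_image.2 ⟨k, by simp [hk], rfl⟩
  have hPk : ∀ x ∈ P, ∃ k, k ≠ i₀ ∧ slack k = x := by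
    intro x hx
    rw [hP] at hx
    obtain ⟨k, hk, rfl⟩ := mem_image.1 hx
    exact ⟨k, by simpa using hk, rfl⟩
  have hcard : P.card + 1 = Fintype.card I := by
    rw [hP, card_image_of_injective _ hslack, card_erase_of_mem (mem_univ i₀), card_univ]
    have := Fintype.card_pos (α := I)
    omega
  have hPne : P.Nonempty := by
    obtain ⟨k, hk⟩ := exists_ne i₀
    exact ⟨_, hmem k hk⟩
  have hD : Dominant r P := by
    intro y
    by_cases hy : y ∈ Set.range slack
    · obtain ⟨l, rfl⟩ := hy
      exact ⟨l, fun x _ => hlow l x⟩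
    · refine ⟨i₀, fun x hx => ?_⟩
      obtain ⟨k, hk, rfl⟩ := hPk x hx
      exact (hhigh i₀ k hk.symm y hy).le
  obtain ⟨m, a, b, hmP, hm, hab, hmab, hE⟩ := exists_extension_indices hr hPne hcard hD
  have hms : ∀ j, j ≠ i₀ → m j = slack j := fun j hj =>
    hr j (le_antisymm (hm j _ (hmem j hj)) (hlow j _))
  obtain ⟨k, hk, hmk⟩ := hPk _ (hmP i₀)
  have habk : ∀ i, (i = a ∨ i = b) ↔ (i = i₀ ∨ i = k) := by
    have h1 : ∀ j, j ≠ i₀ → m j = m i₀ → j = k := fun j hj h =>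
      hslack (by rw [← hms j hj, h, hmk])
    have h2 : ∀ i j, i ≠ i₀ → j ≠ i₀ → m i = m j → i = j := fun i j hi hj h =>
      hslack (by rw [← hms i hi, h, hms j hj])
    grind
  obtain ⟨z₀, hz₀⟩ := hreal
  obtain ⟨y, hy, hymax⟩ : ∃ y, (∀ j, j ≠ i₀ → r j (m j) < r j y) ∧
      ∀ y', (∀ j, j ≠ i₀ → r j (m j) < r j y') → r i₀ y' ≤ r i₀ y := by
    classical
    obtain ⟨y, hy, hy'⟩ := (univ.filter fun y => ∀ j, j ≠ i₀ → r j (m j) < r j y).exists_max_image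
      (r i₀) ⟨z₀, by
        simp only [mem_filter, mem_univ, true_and]
        intro j hj
        rw [hms j hj]
        exact lt_of_le_of_ne (hlow j _) fun h => hz₀ ⟨j, hr j h⟩⟩
    exact ⟨y, (mem_filter.1 hy).2, fun y' h => hy' y' (mem_filter.2 ⟨mem_univ _, h⟩)⟩
  have hempty : ∀ z, ¬ ∀ j, j ≠ k → r j (m j) < r j z := by
    intro z hz
    have hz₀ := hz i₀ hk.symm
    rw [← hmk] at hz₀
    by_cases hzr : z ∈ Set.range slack
    · obtain ⟨l, rfl⟩ := hzr
      by_cases hl : l = i₀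
      · exact absurd (hlow i₀ (slack k)) (not_le.2 (hl ▸ hz₀))
      · by_cases hlk : l = k
        · exact lt_irrefl _ (hlk ▸ hz₀)
        · have := hz l hlk
          rw [hms l hl] at this
          exact lt_irrefl _ this
    · exact lt_asymm hz₀ (hhigh i₀ k hk.symm z hzr)
  rw [card_eq_one]
  refine ⟨y, ?_⟩
  ext z
  simp only [mem_filter, mem_univ, true_and, hE, habk, mem_singleton]
  constructor
  · rintro ⟨i, rfl | rfl, h, h'⟩
    · exact hr i (le_antisymm (hymax z h) (h' _ hy))
    · exact absurd h (hempty z)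
  · rintro rfl
    exact ⟨i₀, Or.inl rfl, hy, hymax⟩

/-- A set missing some colour has an even number of facets carrying every colour but `i₀`. -/
theorem even_card_almost_colorful {c : Z → I} {i₀ : I} {T : Finset Z}
    (hcard : T.card = Fintype.card I) (hT : T.image c ≠ univ) :
    Even (T.filter fun x => (T.erase x).image c = univ.erase i₀).card := by
  rcases (T.filter fun x => (T.erase x).image c = univ.erase i₀).eq_empty_or_nonempty
    with h | ⟨x, h⟩
  · simp [h]
  obtain ⟨hx, hxc⟩ := mem_filter.1 h
  have himg : T.image c = insert (c x) (univ.erase i₀) := by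
    rw [← hxc, ← image_insert, insert_erase hx]
  have hcx : c x ≠ i₀ := by
    rintro rfl
    exact hT (by rw [himg, insert_erase (mem_univ _)])
  have hinj : Set.InjOn c (T.erase x : Finset Z) := by
    apply injOn_of_card_image_eq
    rw [hxc, card_erase_of_mem (mem_univ _), card_univ, card_erase_of_mem hx, hcard]
  obtain ⟨x', hx', hcx'⟩ : ∃ x' ∈ T.erase x, c x' = c x := by
    have : c x ∈ (T.erase x).image c := by rw [hxc]; simp [hcx]
    simpa using this
  have hne : x' ≠ x := (mem_erase.1 hx').1
  have : (T.filter fun x => (T.erase x).image c = univ.erase i₀) = {x, x'} := by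
    ext w
    simp only [mem_filter, mem_insert, mem_singleton]
    constructor
    · rintro ⟨hw, hwc⟩
      by_contra! hw'
      have h1 : c w ∈ (T.erase w).image c := by
        rw [hwc, ← hxc]
        exact mem_image_of_mem _ (mem_erase.2 ⟨hw'.1, hw⟩)
      obtain ⟨v, hv, hvw⟩ := mem_image.1 h1
      have hvw' := (mem_erase.1 hv).1
      by_cases hvx : v = x
      · subst hvx
        exact hw'.2 (hinj (by simp [hw'.1, hw]) (by exact_mod_cast hx') (by rw [hcx', hvw]))
      · exact hvw' (hinj (by simp [hvx, (mem_erase.1 hv).2]) (by simp [hw'.1, hw]) hvw)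
    · rintro (rfl | rfl)
      · exact ⟨hx, hxc⟩
      · refine ⟨(mem_erase.1 hx').2, ?_⟩
        rw [← hxc]
        ext k
        simp only [mem_image, mem_erase]
        constructor
        · rintro ⟨v, ⟨hv, hvT⟩, rfl⟩
          by_cases hvx : v = x
          · exact ⟨w, ⟨hne, (mem_erase.1 hx').2⟩, hvx ▸ hcx'⟩
          · exact ⟨v, ⟨hvx, hvT⟩, rfl⟩
        · rintro ⟨v, ⟨hv, hvT⟩, rfl⟩
          by_cases hvx : v = w
          · exact ⟨x, ⟨hne.symm, hx⟩, hvx ▸ hcx'.symm⟩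
          · exact ⟨v, ⟨hvx, hvT⟩, rfl⟩
  rw [this, card_pair hne.symm]
  exact even_two

/-- **Scarf's lemma**: there is a dominant set carrying every colour. -/
theorem exists_dominant_colorful [Fintype Z] [Nontrivial I] {r : I → Z → α}
    (hr : ∀ i, Function.Injective (r i)) {slack : I → Z}
    (hlow : ∀ i z, r i (slack i) ≤ r i z)
    (hhigh : ∀ i j, i ≠ j → ∀ z, z ∉ Set.range slack → r i z < r i (slack j))
    (hreal : ∃ z, z ∉ Set.range slack) {c : Z → I} (hc : ∀ i, c (slack i) = i) :
    ∃ T : Finset Z, T.card = Fintype.card I ∧ Dominant r T ∧ T.image c = univ := by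
  classical
  by_contra! hno
  have hslack : Function.Injective slack := Function.LeftInverse.injective hc
  obtain ⟨i₀⟩ : Nonempty I := inferInstance
  let R : Finset (Finset Z) := univ.filter fun T => T.card = Fintype.card I ∧ Dominant r T
  let Q : Finset (Finset Z) :=
    univ.filter fun P => P.card + 1 = Fintype.card I ∧ P.image c = univ.erase i₀
  have hcount := sum_card_bipartiteAbove_eq_sum_card_bipartiteBelow (s := Q) (t := R)
    (fun P T => P ⊆ T)
  have hdoor : ∀ P ∈ Q, (R.bipartiteAbove (fun P T => P ⊆ T) P).card =
      (univ.filter fun y => y ∉ P ∧ Dominant r (insert y P)).card := by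
    intro P hP
    obtain ⟨hPc, -⟩ := (mem_filter.1 hP).2
    symm
    apply card_bij (fun y _ => insert y P)
    · intro y hy
      obtain ⟨hyP, hyD⟩ := (mem_filter.1 hy).2
      refine mem_bipartiteAbove _ |>.2 ⟨?_, subset_insert _ _⟩
      exact mem_filter.2 ⟨mem_univ _, by rw [card_insert_of_notMem hyP, hPc], hyD⟩
    · intro y hy z hz h
      obtain ⟨hyP, -⟩ := (mem_filter.1 hy).2
      exact (mem_insert.1 (h ▸ mem_insert_self y P)).resolve_right hyP
    · intro T hT
      obtain ⟨hTR, hPT⟩ := (mem_bipartiteAbove _).1 hT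
      obtain ⟨hTc, hTD⟩ := (mem_filter.1 hTR).2
      have h1 : (T \ P).card = 1 := by rw [card_sdiff_of_subset hPT]; omega
      obtain ⟨y, hy⟩ := card_eq_one.1 h1
      have hyT : y ∈ T \ P := by simp [hy]
      have hins : insert y P = T := by
        rw [insert_eq, ← hy, sdiff_union_of_subset hPT]
      exact ⟨y, mem_filter.2 ⟨mem_univ _, (mem_sdiff.1 hyT).2, hins ▸ hTD⟩, hins⟩
  have hroom : ∀ T ∈ R, Even (Q.bipartiteBelow (fun P T => P ⊆ T) T).card := by
    intro T hT
    obtain ⟨hTc, hTD⟩ := (mem_filter.1 hT).2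
    convert even_card_almost_colorful (i₀ := i₀) hTc (hno T hTc hTD) using 1
    symm
    apply card_bij (fun x _ => T.erase x)
    · intro x hx
      obtain ⟨hxT, hxc⟩ := mem_filter.1 hx
      refine mem_bipartiteBelow _ |>.2 ⟨?_, erase_subset _ _⟩
      exact mem_filter.2 ⟨mem_univ _, by rw [card_erase_add_one hxT, hTc], hxc⟩
    · intro x hx y hy h
      by_contra hxy
      have : x ∈ T.erase y := mem_erase.2 ⟨hxy, (mem_filter.1 hx).1⟩
      rw [← h] at this
      exact (mem_erase.1 this).1 rfl
    · intro P hP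
      obtain ⟨hPQ, hPT⟩ := (mem_bipartiteBelow _).1 hP
      obtain ⟨hPc, hPi⟩ := (mem_filter.1 hPQ).2
      have h1 : (T \ P).card = 1 := by rw [card_sdiff_of_subset hPT]; omega
      obtain ⟨y, hy⟩ := card_eq_one.1 h1
      have hyT : y ∈ T \ P := by simp [hy]
      have hins : T.erase y = P := by
        rw [← sdiff_singleton_eq_erase, ← hy, Finset.sdiff_sdiff_eq_self hPT]
      exact ⟨y, mem_filter.2 ⟨(mem_sdiff.1 hyT).1, hins ▸ hPi⟩, hins⟩
  have heven : Even (∑ T ∈ R, (Q.bipartiteBelow (fun P T => P ⊆ T) T).card) :=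
    even_sum _ hroom
  have hP₀ : (univ.erase i₀).image slack ∈ Q := by
    refine mem_filter.2 ⟨mem_univ _, ?_, ?_⟩
    · rw [card_image_of_injective _ hslack, card_erase_of_mem (mem_univ i₀), card_univ]
      have := Fintype.card_pos (α := I)
      omega
    · rw [image_image, show c ∘ slack = id from funext hc, image_id]
  rw [← hcount, ← add_sum_erase _ _ hP₀, hdoor _ hP₀,
    card_extensions_slack hr hslack hlow hhigh hreal i₀ rfl] at heven
  have hrest : Even (∑ P ∈ Q.erase ((univ.erase i₀).image slack),
      (R.bipartiteAbove (fun P T => P ⊆ T) P).card) := by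
    refine even_sum _ fun P hP => ?_
    obtain ⟨hPne, hPQ⟩ := mem_erase.1 hP
    rw [hdoor P hPQ]
    obtain ⟨hPc, hPi⟩ := (mem_filter.1 hPQ).2
    apply even_card_extensions hr hslack hlow hhigh ?_ hPc
    · intro i hi
      have h1 : P.image c = univ.erase i := by
        rw [hi, image_image, show c ∘ slack = id from funext hc, image_id]
      have h2 : i = i₀ := by
        by_contra hne
        have : i ∈ (univ.erase i : Finset I) := by
          rw [← h1, hPi]; simp [hne]
        simp at this
      exact hPne (h2 ▸ hi)
    · rw [← card_pos]
      have := Fintype.one_lt_card (α := I)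
      omega
  grind

end Scarf

section ClosedCover

variable {I : Type*} [Fintype I] [DecidableEq I] [Nontrivial I]

/-- Scarf's lemma applied to the grid of mesh `1 / N` on the standard simplex. -/
theorem exists_approx_mem_cover {A : I → Set (I → ℝ)}
    (hcover : ∀ z ∈ stdSimplex ℝ I, ∃ i, z ∈ A i) {N : ℕ} (hN : 0 < N) :
    ∃ z ∈ stdSimplex ℝ I, ∀ i, z i ≤ (Fintype.card I : ℝ) / N ∨
      ∃ x ∈ A i, dist x z ≤ (Fintype.card I : ℝ) / N := by
  classical
  have hN' : (0 : ℝ) < N := by exact_mod_cast hN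
  let X := {x : I → Fin (N + 1) // ∑ i, (x i : ℕ) = N}
  have mkX : ∀ x : I → ℕ, ∑ i, x i = N → ∃ y : X, ∀ i, (y.1 i : ℕ) = x i := by
    intro x hx
    have : ∀ i, x i < N + 1 := fun i =>
      Nat.lt_succ_of_le (hx ▸ single_le_sum (fun _ _ => Nat.zero_le _) (mem_univ i))
    exact ⟨⟨fun i => ⟨x i, this i⟩, hx⟩, fun i => rfl⟩
  let pt : X → I → ℝ := fun x i => (x.1 i : ℕ) / (N : ℝ)
  have hpt : ∀ x, pt x ∈ stdSimplex ℝ I := by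
    intro x
    refine ⟨fun i => by positivity, ?_⟩
    simp only [pt]
    rw [← sum_div, ← Nat.cast_sum, x.2, div_self hN'.ne']
  choose col hcol using fun x => hcover (pt x) (hpt x)
  let coord : I → X ⊕ I → ℤ := fun i =>
    Sum.elim (fun x => (x.1 i : ℕ)) (fun k => if k = i then -1 else N + 1)
  let r : I → X ⊕ I → ℤ ×ₗ Fin (Fintype.card (X ⊕ I)) := fun i z =>
    toLex (coord i z, Fintype.equivFin (X ⊕ I) z)
  have hr : ∀ i, Function.Injective (r i) := fun i z w h =>
    (Fintype.equivFin (X ⊕ I)).injective (congrArg (fun t => (ofLex t).2) h)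
  have hle : ∀ i z w, r i z ≤ r i w → coord i z ≤ coord i w := fun i z w h => by
    rcases Prod.Lex.le_iff.1 h with h | h
    · exact le_of_lt h
    · exact h.1.le
  have hlt : ∀ i z w, coord i z < coord i w → r i z < r i w := fun i z w h =>
    Prod.Lex.lt_iff.2 (Or.inl h)
  have hcoordX : ∀ i (x : X), 0 ≤ coord i (Sum.inl x) ∧ coord i (Sum.inl x) ≤ N := fun i x => by
    have := (x.1 i).2
    simp only [coord, Sum.elim_inl]
    omega
  have hlow : ∀ i z, r i (Sum.inr i) ≤ r i z := by
    intro i z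
    by_cases hz : z = Sum.inr i
    · rw [hz]
    · refine (hlt i _ _ ?_).le
      rcases z with x | k
      · have := hcoordX i x
        simp only [coord, Sum.elim_inr, if_true] at this ⊢
        omega
      · have : k ≠ i := fun h => hz (h ▸ rfl)
        simp only [coord, Sum.elim_inr, if_true, this, if_false]
        omega
  have hhigh : ∀ i j, i ≠ j → ∀ z, z ∉ Set.range (Sum.inr : I → X ⊕ I) →
      r i z < r i (Sum.inr j) := by
    rintro i j hij (x | k) hz
    · refine hlt i _ _ ?_
      have := hcoordX i x
      simp only [coord, Sum.elim_inr, hij.symm, if_false] at this ⊢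
      omega
    · exact absurd ⟨k, rfl⟩ hz
  obtain ⟨i₀⟩ : Nonempty I := inferInstance
  obtain ⟨x₀, -⟩ := mkX (fun i => if i = i₀ then N else 0) (by simp)
  obtain ⟨T, -, hTD, hTc⟩ := exists_dominant_colorful hr hlow hhigh
    ⟨Sum.inl x₀, by simp⟩ (c := Sum.elim col id) (fun _ => rfl)
  have hcol' : ∀ i, Sum.inr i ∉ T → ∃ x, Sum.inl x ∈ T ∧ col x = i := by
    intro i hi
    have : i ∈ T.image (Sum.elim col id) := hTc ▸ mem_univ i
    obtain ⟨x | k, hx, hxi⟩ := mem_image.1 this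
    · exact ⟨x, hx, hxi⟩
    · simp only [Sum.elim_inr, id] at hxi
      exact absurd (hxi ▸ hx) hi
  let D : Finset I := univ.filter fun i => Sum.inr i ∉ T
  have hD : ∀ i, i ∈ D ↔ Sum.inr i ∉ T := fun i => by simp [D]
  have hreal : ∀ x : X, ∃ i ∈ D, ∀ y : X, Sum.inl y ∈ T → (x.1 i : ℕ) ≤ (y.1 i : ℕ) := by
    intro x
    obtain ⟨i, hi⟩ := hTD (Sum.inl x)
    refine ⟨i, (hD i).2 fun h => ?_, fun y hy => ?_⟩
    · have h1 := hle i _ _ (hi _ h)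
      have h2 := hcoordX i x
      simp only [coord, Sum.elim_inr, if_true] at h1 h2
      omega
    · have h1 := hle i _ _ (hi _ hy)
      simp only [coord, Sum.elim_inl] at h1
      omega
  obtain ⟨d, hdD, -⟩ := hreal x₀
  obtain ⟨x, hxT, -⟩ := hcol' d ((hD d).1 hdD)
  have hmin : ∀ i, ∃ y : X, Sum.inl y ∈ T ∧
      ∀ z : X, Sum.inl z ∈ T → (y.1 i : ℕ) ≤ (z.1 i : ℕ) := by
    intro i
    obtain ⟨y, hy, hy'⟩ := (univ.filter fun y : X => Sum.inl y ∈ T).exists_min_image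
      (fun y => (y.1 i : ℕ)) ⟨x, by simpa using hxT⟩
    exact ⟨y, by simpa using hy, fun z hz => hy' z (by simpa using hz)⟩
  choose μ hμT hμ using hmin
  have hsum : N < ∑ i ∈ D, ((μ i).1 i + 1 : ℕ) := by
    by_contra! hle'
    obtain ⟨y, hy⟩ := mkX
      (fun i => (if i ∈ D then ((μ i).1 i + 1 : ℕ) else 0) +
        if i = d then N - ∑ i ∈ D, ((μ i).1 i + 1 : ℕ) else 0) (by
          rw [sum_add_distrib, sum_ite_mem, univ_inter, sum_ite_eq' univ d]
          simp only [mem_univ, if_true]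
          omega)
    obtain ⟨i, hiD, hi⟩ := hreal y
    have h1 := hi _ (hμT i)
    rw [hy i, if_pos hiD] at h1
    omega
  have hDcard : ∑ i ∈ D, ((μ i).1 i + 1 : ℕ) ≤ ∑ i ∈ D, ((μ i).1 i : ℕ) + Fintype.card I := by
    rw [sum_add_distrib]
    have := card_le_univ D
    simpa using this
  have hclose : ∀ y z : X, Sum.inl y ∈ T → Sum.inl z ∈ T → ∀ i,
      (y.1 i : ℕ) ≤ (z.1 i : ℕ) + Fintype.card I ∧
        (i ∉ D → (y.1 i : ℕ) ≤ Fintype.card I) := by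
    intro y z hy hz i
    have hyN : ∑ j ∈ D, (y.1 j : ℕ) ≤ N :=
      (sum_le_sum_of_subset (subset_univ D)).trans_eq y.2
    by_cases hi : i ∈ D
    · refine ⟨?_, fun h => absurd hi h⟩
      have h1 : ∑ j ∈ D.erase i, ((μ j).1 j : ℕ) ≤ ∑ j ∈ D.erase i, (y.1 j : ℕ) :=
        sum_le_sum fun j _ => hμ j y hy
      have h2 := hμ i z hz
      have h3 := add_sum_erase D (fun j => ((μ j).1 j : ℕ)) hi
      have h4 := add_sum_erase D (fun j => (y.1 j : ℕ)) hi
      omega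
    · have hyN' : (y.1 i : ℕ) + ∑ j ∈ D, (y.1 j : ℕ) ≤ N :=
        (sum_insert (f := fun j => (y.1 j : ℕ)) hi).symm.trans_le
          ((sum_le_sum_of_subset (subset_univ _)).trans_eq y.2)
      have h1 : ∑ j ∈ D, ((μ j).1 j : ℕ) ≤ ∑ j ∈ D, (y.1 j : ℕ) :=
        sum_le_sum fun j _ => hμ j y hy
      exact ⟨by omega, fun _ => by omega⟩
  refine ⟨pt x, hpt x, fun i => ?_⟩
  by_cases hi : i ∈ D
  · right
    obtain ⟨y, hyT, rfl⟩ := hcol' i ((hD i).1 hi)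
    refine ⟨pt y, hcol y, (dist_pi_le_iff (by positivity)).2 fun j => ?_⟩
    have h1 : ((y.1 j : ℕ) : ℝ) ≤ (x.1 j : ℕ) + Fintype.card I := by
      exact_mod_cast (hclose y x hyT hxT j).1
    have h2 : ((x.1 j : ℕ) : ℝ) ≤ (y.1 j : ℕ) + Fintype.card I := by
      exact_mod_cast (hclose x y hxT hyT j).1
    rw [Real.dist_eq]
    simp only [pt]
    rw [← sub_div, abs_div, abs_of_pos hN']
    gcongr
    exact abs_sub_le_iff.2 ⟨by linarith, by linarith⟩
  · left
    simp only [pt]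
    gcongr
    exact (hclose x x hxT hxT i).2 hi

/-- If closed sets `A i` cover the standard simplex, then some point of it lies in every `A i` with
`i` in its support. -/
theorem exists_mem_of_isClosed_cover {A : I → Set (I → ℝ)} (hA : ∀ i, IsClosed (A i))
    (hcover : ∀ z ∈ stdSimplex ℝ I, ∃ i, z ∈ A i) :
    ∃ z ∈ stdSimplex ℝ I, ∀ i, 0 < z i → z ∈ A i := by
  choose z hz hzA using fun N : ℕ => exists_approx_mem_cover hcover N.succ_pos
  obtain ⟨w, hw, φ, hφ, hlim⟩ := (isCompact_stdSimplex ℝ I).tendsto_subseq hz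
  refine ⟨w, hw, fun i hi => ?_⟩
  have hmesh : Filter.Tendsto (fun k => (Fintype.card I : ℝ) / ((φ k).succ : ℕ))
      Filter.atTop (nhds 0) :=
    (tendsto_const_div_atTop_nhds_zero_nat (Fintype.card I : ℝ)).comp
      ((Filter.tendsto_add_atTop_nat 1).comp hφ.tendsto_atTop)
  rw [← (hA i).closure_eq, Metric.mem_closure_iff]
  intro ε hε
  have hcoord : Filter.Tendsto (fun k => z (φ k) i) Filter.atTop (nhds (w i)) :=
    ((continuous_apply i).tendsto w).comp hlim
  have h1 := hmesh.eventually_lt hcoord hi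
  have h2 := hmesh.eventually_lt_const (half_pos hε)
  have h3 := (Metric.tendsto_nhds.1 hlim) (ε / 2) (half_pos hε)
  obtain ⟨k, hk1, hk2, hk3⟩ := (h1.and (h2.and h3)).exists
  obtain ⟨x, hx, hxz⟩ := (hzA (φ k) i).resolve_left (not_le.2 hk1)
  refine ⟨x, hx, ?_⟩
  rw [dist_comm]
  calc dist x w ≤ dist x (z (φ k)) + dist (z (φ k)) w := dist_triangle _ _ _
    _ < ε := by
      have : dist (z (φ k)) w < ε / 2 := hk3
      linarith

end ClosedCover

/-- A continuous map on the positive orthant that is negative on the faces, and changes sign at the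
maximal coordinate between the sup-norm spheres of radius `s` and `R`, has a positive zero whose
sup norm lies strictly between `s` and `R`. -/
theorem exists_pos_zero {ι : Type*} [Fintype ι] [DecidableEq ι] [Nonempty ι]
    {g : (ι → ℝ) → ι → ℝ} (hg : Continuous g) {s R : ℝ} (hs : 0 < s) (hR : 0 ≤ R)
    (hface : ∀ u : ι → ℝ, (∀ y, 0 ≤ u y) → ∀ x, u x = 0 → g u x < 0)
    (hinner : ∀ u : ι → ℝ, (∀ y, 0 ≤ u y) → (∀ y, u y ≤ s) → ∀ x, u x = s → 0 < g u x)
    (houter : ∀ u : ι → ℝ, (∀ y, 0 ≤ u y) → (∀ y, u y ≤ R) → ∀ x, u x = R → g u x < 0) :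
    ∃ u : ι → ℝ, (∀ x, 0 < u x) ∧ (∀ x, g u x = 0) ∧ ∃ t : ℝ, 0 < t ∧ t < 1 ∧
      (∀ y, u y ≤ s + t * (R - s)) ∧ ∃ x, u x = s + t * (R - s) := by
  let top : (Option ι → ℝ) → ℝ := fun z => univ.sup' univ_nonempty fun x => z (some x)
  let c : ℝ := 1 / (2 * Fintype.card ι)
  have hι : (0 : ℝ) < Fintype.card ι := by exact_mod_cast Fintype.card_pos
  have hc : 0 < c := by positivity
  let rad : (Option ι → ℝ) → ℝ := fun z => s + 2 * z none * (R - s)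
  let U : (Option ι → ℝ) → ι → ℝ := fun z x => rad z * z (some x) / max (top z) c
  have htop : Continuous top :=
    Continuous.finset_sup'_apply univ_nonempty fun x _ => continuous_apply (some x)
  have hU : Continuous U := by
    refine continuous_pi fun x => Continuous.div ?_ (htop.max continuous_const) fun z =>
      (lt_max_of_lt_right hc).ne'
    fun_prop
  have hgU : ∀ x, Continuous fun z => g (U z) x := fun x =>
    (continuous_apply x).comp (hg.comp hU)
  have hnone : Continuous fun z : Option ι → ℝ => z none := continuous_apply none
  let A : Option ι → Set (Option ι → ℝ) := fun o => o.elim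
    ({z | z none ≤ 1 / 2} ∩ ⋂ x, {z | 0 ≤ g (U z) x})
    fun x => ((⋂ y, {z | g (U z) x ≤ g (U z) y}) ∩ {z | g (U z) x ≤ 0}) ∪ {z | 1 / 2 ≤ z none}
  have hA : ∀ o, IsClosed (A o) := by
    rintro (_ | x)
    · exact (isClosed_le hnone continuous_const).inter
        (isClosed_iInter fun x => isClosed_le continuous_const (hgU x))
    · exact ((isClosed_iInter fun y => isClosed_le (hgU x) (hgU y)).inter
        (isClosed_le (hgU x) continuous_const)).union (isClosed_le continuous_const hnone)
  have hAnone : ∀ z, z ∈ A none ↔ z none ≤ 1 / 2 ∧ ∀ x, 0 ≤ g (U z) x := fun z => by simp [A]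
  have hAsome : ∀ x z, z ∈ A (some x) ↔
      ((∀ y, g (U z) x ≤ g (U z) y) ∧ g (U z) x ≤ 0) ∨ 1 / 2 ≤ z none := fun x z => by simp [A]
  have hcover : ∀ z ∈ stdSimplex ℝ (Option ι), ∃ o, z ∈ A o := by
    intro z _
    obtain ⟨x, -, hx⟩ := (univ : Finset ι).exists_min_image (g (U z)) univ_nonempty
    by_cases hz : 1 / 2 ≤ z none
    · exact ⟨some x, (hAsome x z).2 (Or.inr hz)⟩
    · by_cases h0 : g (U z) x ≤ 0
      · exact ⟨some x, (hAsome x z).2 (Or.inl ⟨fun y => hx y (mem_univ y), h0⟩)⟩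
      · exact ⟨none, (hAnone z).2 ⟨(not_le.1 hz).le,
          fun y => (not_le.1 h0).le.trans (hx y (mem_univ y))⟩⟩
  obtain ⟨z, ⟨hz0, hz1⟩, hz⟩ := exists_mem_of_isClosed_cover hA hcover
  rw [Fintype.sum_option] at hz1
  have hle : z none ≤ 1 / 2 := by
    rcases (hz0 none).eq_or_lt with h | h
    · rw [← h]; norm_num
    · exact ((hAnone z).1 (hz none h)).1
  have htop_le : ∀ x, z (some x) ≤ top z := fun x =>
    le_sup' (fun x => z (some x)) (mem_univ x)
  have hctop : c ≤ top z := by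
    have h1 : ∑ x, z (some x) ≤ Fintype.card ι * top z := by
      simpa using sum_le_card_nsmul univ (fun x => z (some x)) (top z) fun x _ => htop_le x
    simp only [c]
    rw [div_le_iff₀ (by positivity)]
    linarith
  have htop_pos : 0 < top z := hc.trans_le hctop
  have hUz : ∀ x, U z x = rad z * z (some x) / top z := fun x => by
    simp only [U, max_eq_left hctop]
  have hrad : 0 ≤ rad z := by
    have h1 := hz0 none
    have : rad z = s * (1 - 2 * z none) + 2 * z none * R := by simp only [rad]; ring
    rw [this]
    have : 0 ≤ 1 - 2 * z none := by linarith
    positivity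
  have hU0 : ∀ x, 0 ≤ U z x := fun x => by
    have := hz0 (some x)
    rw [hUz]; positivity
  have hUle : ∀ x, U z x ≤ rad z := fun x => by
    rw [hUz, div_le_iff₀ htop_pos]
    exact mul_le_mul_of_nonneg_left (htop_le x) hrad
  obtain ⟨x₀, -, hx₀⟩ := exists_mem_eq_sup' (univ_nonempty (α := ι)) fun x => z (some x)
  have hx₀' : top z = z (some x₀) := hx₀
  have hUx₀ : U z x₀ = rad z := by
    rw [hUz, ← hx₀', mul_div_cancel_right₀ _ htop_pos.ne']
  have hlt : z none < 1 / 2 := by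
    refine lt_of_le_of_ne hle fun h => ?_
    have hradR : rad z = R := by simp only [rad, h]; ring
    have h1 := ((hAnone z).1 (hz none (by rw [h]; norm_num))).2 x₀
    exact absurd h1 (not_le.2 (houter _ hU0 (hradR ▸ hUle) x₀ (hUx₀.trans hradR)))
  have hsome : ∀ x, 0 < z (some x) → g (U z) x ≤ 0 := fun x hx =>
    (((hAsome x z).1 (hz _ hx)).resolve_right (not_le.2 hlt)).2
  have hpos : 0 < z none := by
    refine lt_of_le_of_ne (hz0 none) fun h => ?_
    have hrads : rad z = s := by simp only [rad, ← h]; ring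
    exact absurd (hsome x₀ (hx₀' ▸ htop_pos))
      (not_le.2 (hinner _ hU0 (hrads ▸ hUle) x₀ (hUx₀.trans hrads)))
  have hnonneg := ((hAnone z).1 (hz none hpos)).2
  have hsupp : ∀ x, 0 < z (some x) := fun x => by
    refine lt_of_le_of_ne (hz0 _) fun h => ?_
    exact absurd (hnonneg x) (not_le.2 (hface _ hU0 x (by rw [hUz, ← h]; simp)))
  have hrad_pos : 0 < rad z := by
    have : rad z = s * (1 - 2 * z none) + 2 * z none * R := by simp only [rad]; ring
    rw [this]
    have : 0 < 1 - 2 * z none := by linarith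
    positivity
  refine ⟨U z, fun x => ?_, fun x => le_antisymm (hsome x (hsupp x)) (hnonneg x),
    2 * z none, by linarith, by linarith, hUle, x₀, hUx₀⟩
  have := hsupp x
  rw [hUz]; positivity

/-- The smallness of `lam` makes the constant `N ^ (-1/2) / 2` a strict supersolution. -/
theorem strict_supersolution_of_lt {P m Q Φ Ψ N b k lam : ℝ} (hP : 2 ≤ P) (hm : 2 ≤ m)
    (hQ : 0 < Q) (hΦ : 0 < Φ) (hΨ : 0 < Ψ) (hN : 2 ≤ N) (hb : 0 ≤ b) (hbN : b ≤ N) (hk : 1 ≤ k)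
    (hlam : 0 < lam)
    (hlt : lam < Q / P * (2 : ℝ) ^ (-(P / 2)) * b ^ (P / 2) * N ^ (1 - P) * N ^ (-(P / 2)) /
      ((Φ / m * N ^ (-(m / 2)) + Ψ) * k)) :
    lam * (Φ * (2⁻¹ * N ^ (-(1 / 2) : ℝ)) ^ (m - 1) + Ψ) <
      Q * (2⁻¹ * N ^ (-(1 / 2) : ℝ)) ^ (P - 1) := by
  have hN0 : 0 < N := by linarith
  have hs : ∀ e : ℝ, (2⁻¹ * N ^ (-(1 / 2) : ℝ)) ^ (e - 1) =
      (2 : ℝ) ^ (1 - e) * (N ^ (1 / 2 : ℝ) * N ^ (-(e / 2))) := by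
    intro e
    rw [Real.mul_rpow (by norm_num) (by positivity), Real.inv_rpow (by norm_num),
      ← Real.rpow_neg (by norm_num), ← Real.rpow_mul hN0.le, ← Real.rpow_add hN0]
    ring_nf
  set D := Φ / m * N ^ (-(m / 2)) + Ψ with hD
  have hDpos : 0 < D := by positivity
  have hsqrt : 1 ≤ N ^ (1 / 2 : ℝ) := Real.one_le_rpow (by linarith) (by norm_num)
  have hpow : (2 : ℝ) ^ (1 - m) ≤ 1 / m := by
    have h := one_add_mul_self_le_rpow_one_add (s := 1) (by norm_num) (p := m - 1) (by linarith)
    rw [show 1 - m = -(m - 1) by ring, Real.rpow_neg (by norm_num), ← one_div]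
    apply one_div_le_one_div_of_le (by linarith)
    norm_num at h
    exact h
  have h1 : Φ * (2⁻¹ * N ^ (-(1 / 2) : ℝ)) ^ (m - 1) + Ψ ≤ N ^ (1 / 2 : ℝ) * D := by
    rw [hs, hD, mul_add]
    apply add_le_add
    · calc Φ * ((2 : ℝ) ^ (1 - m) * (N ^ (1 / 2 : ℝ) * N ^ (-(m / 2))))
          ≤ Φ * (1 / m * (N ^ (1 / 2 : ℝ) * N ^ (-(m / 2)))) := by gcongr
        _ = _ := by ring
    · exact le_mul_of_one_le_left hΨ.le hsqrt
  have h2 : lam * D < Q / P * (2 : ℝ) ^ (-(P / 2)) * N ^ (1 - P) := by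
    rw [lt_div_iff₀ (by positivity)] at hlt
    calc lam * D ≤ lam * (D * k) := by gcongr; exact le_mul_of_one_le_right hDpos.le hk
      _ < Q / P * (2 : ℝ) ^ (-(P / 2)) * b ^ (P / 2) * N ^ (1 - P) * N ^ (-(P / 2)) := hlt
      _ ≤ Q / P * (2 : ℝ) ^ (-(P / 2)) * N ^ (P / 2) * N ^ (1 - P) * N ^ (-(P / 2)) := by gcongr
      _ = Q / P * (2 : ℝ) ^ (-(P / 2)) * N ^ (1 - P) * (N ^ (P / 2) * N ^ (-(P / 2))) := by ring
      _ = _ := by rw [← Real.rpow_add hN0, add_neg_cancel, Real.rpow_zero, mul_one]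
  have h3 : Q / P * (2 : ℝ) ^ (-(P / 2)) * N ^ (1 - P) ≤
      Q * ((2 : ℝ) ^ (1 - P) * N ^ (-(P / 2))) := by
    have e1 : N ^ (1 - P) = N ^ (1 - P / 2) * N ^ (-(P / 2)) := by
      rw [← Real.rpow_add hN0]; ring_nf
    have e2 : (2 : ℝ) ^ (1 - P) = (2 : ℝ) ^ (-(P / 2)) * 2 ^ (1 - P / 2) := by
      rw [← Real.rpow_add (by norm_num)]; ring_nf
    have e3 : N ^ (1 - P / 2) ≤ (2 : ℝ) ^ (1 - P / 2) :=
      Real.rpow_le_rpow_of_nonpos (by norm_num) hN (by linarith)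
    have e4 : Q / P ≤ Q := div_le_self hQ.le (by linarith)
    calc Q / P * (2 : ℝ) ^ (-(P / 2)) * N ^ (1 - P)
        ≤ Q * (2 : ℝ) ^ (-(P / 2)) * (2 ^ (1 - P / 2) * N ^ (-(P / 2))) := by rw [e1]; gcongr
      _ = _ := by rw [e2]; ring
  calc lam * (Φ * (2⁻¹ * N ^ (-(1 / 2) : ℝ)) ^ (m - 1) + Ψ) ≤ lam * (N ^ (1 / 2 : ℝ) * D) := by
        gcongr
    _ = N ^ (1 / 2 : ℝ) * (lam * D) := by ring
    _ < N ^ (1 / 2 : ℝ) * (Q * ((2 : ℝ) ^ (1 - P) * N ^ (-(P / 2)))) := by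
        exact mul_lt_mul_of_pos_left (h2.trans_le h3) (by positivity)
    _ = _ := by rw [hs]; ring

/-- Large constants are strict subsolutions when the reaction is superlinear. -/
theorem exists_large_subsolution {V : Type*} (S : Finset V) {C p m κ : V → ℝ}
    (hκ : ∀ x ∈ S, 0 < κ x) (hpm : ∀ x ∈ S, p x < m x) (s : ℝ) :
    ∃ M : ℝ, s < M ∧ ∀ x ∈ S, C x * M ^ (p x - 1) < κ x * M ^ (m x - 1) := by
  have h : ∀ x ∈ S, ∀ᶠ M : ℝ in Filter.atTop, C x * M ^ (p x - 1) < κ x * M ^ (m x - 1) := by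
    intro x hx
    have ht := (tendsto_rpow_atTop (sub_pos.2 (hpm x hx))).eventually_gt_atTop (C x / κ x)
    filter_upwards [ht, Filter.eventually_gt_atTop 0] with M hM hM0
    rw [div_lt_iff₀ (hκ x hx)] at hM
    rw [show m x - 1 = (m x - p x) + (p x - 1) by ring, Real.rpow_add hM0, ← mul_assoc]
    have : 0 < M ^ (p x - 1) := by positivity
    gcongr
    linarith
  exact ((Filter.eventually_gt_atTop s).and ((Filter.eventually_all_finset S).2 h)).exists

/-- Under condition (f.1) and `m₁⁻ > p̄⁺`, for every `λ ∈ (0, λ₂)` the problem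
`−Δ_{p(x),ω}u(x) + q(x)|u(x)|^{p(x)−2}u(x) = λ f(x,u(x))` on `S`, `u = 0` on
`∂S`, has at least two distinct positive solutions. -/
theorem stmt_19 {V : Type*} [Fintype V] [DecidableEq V] [Nonempty V]
    (S B : Finset V) (hS : S.Nonempty) (hB : B.Nonempty)
    (hdisj : Disjoint S B) (hcover : S ∪ B = Finset.univ)
    (ω : V → V → ℝ) (hsym : ∀ x y, ω x y = ω y x) (hnn : ∀ x y, 0 ≤ ω x y)
    (p : V → ℝ) (hp : ∀ x, 2 ≤ p x)
    (q : V → ℝ) (hq : ∀ x ∈ S, 0 < q x)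
    (f : V → ℝ → ℝ) (hfc : ∀ x ∈ S, Continuous (f x))
    -- condition (f.1)
    (m1 m2 φ1 φ2 ψ1 ψ2 : V → ℝ)
    (hm1 : ∀ x ∈ S, 2 ≤ m1 x) (hm2 : ∀ x ∈ S, 2 ≤ m2 x)
    (hφ1 : ∀ x ∈ S, 0 < φ1 x) (hφ2 : ∀ x ∈ S, 0 < φ2 x)
    (hψ1 : ∀ x ∈ S, 0 < ψ1 x) (hψ2 : ∀ x ∈ S, 0 < ψ2 x)
    (hf1 : ∀ x ∈ S, ∀ t : ℝ, 0 ≤ t →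
      ψ1 x + φ1 x * t ^ (m1 x - 1) ≤ f x t ∧ f x t ≤ φ2 x * t ^ (m2 x - 1) + ψ2 x)
    -- m₁⁻ > p̄⁺
    (hm1p : Finset.univ.sup' Finset.univ_nonempty p < S.inf' hS m1)
    -- λ₂
    (lam2 : ℝ)
    (hlam2 : lam2 =
      (S.inf' hS q / S.sup' hS p) * (2 : ℝ) ^ (-(S.sup' hS p / 2)) *
          (B.card : ℝ) ^ (S.sup' hS p / 2) *
          (Fintype.card V : ℝ) ^ (1 - S.sup' hS p) *
          (Fintype.card V : ℝ) ^ (-(S.sup' hS p / 2)) /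
        ((S.sup' hS φ2 / S.inf' hS m2 *
            (Fintype.card V : ℝ) ^ (-(S.inf' hS m2 / 2)) + S.sup' hS ψ2) *
          (S.card : ℝ)))
    (lam : ℝ) (hlam : 0 < lam) (hlt : lam < lam2) :
    ∃ u₁ u₂ : V → ℝ, u₁ ≠ u₂ ∧
      ((∀ x ∈ B, u₁ x = 0) ∧ (∀ x ∈ S, 0 < u₁ x) ∧
        ∀ x ∈ S,
          -(∑ y, |u₁ y - u₁ x| ^ (p x - 2) * (u₁ y - u₁ x) * ω x y)
            + q x * |u₁ x| ^ (p x - 2) * u₁ x = lam * f x (u₁ x)) ∧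
      ((∀ x ∈ B, u₂ x = 0) ∧ (∀ x ∈ S, 0 < u₂ x) ∧
        ∀ x ∈ S,
          -(∑ y, |u₂ y - u₂ x| ^ (p x - 2) * (u₂ y - u₂ x) * ω x y)
            + q x * |u₂ x| ^ (p x - 2) * u₂ x = lam * f x (u₂ x)) := by
  have hN : 2 ≤ Fintype.card V := by
    rw [← card_univ, ← hcover, card_union_of_disjoint hdisj]
    have := hS.card_pos
    have := hB.card_pos
    omega
  let G : (V → ℝ) → V → ℝ := fun v x =>
    -(∑ y, |v y - v x| ^ (p x - 2) * (v y - v x) * ω x y) + q x * |v x| ^ (p x - 2) * v x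
      - lam * f x (v x)
  have hGface : ∀ v : V → ℝ, (∀ y, 0 ≤ v y) → ∀ x ∈ S, v x = 0 → G v x < 0 := by
    intro v hv x hx hvx
    have h1 : 0 ≤ ∑ y, |v y - v x| ^ (p x - 2) * (v y - v x) * ω x y :=
      sum_nonneg fun y _ => mul_nonneg (mul_nonneg (by positivity)
        (by rw [hvx, sub_zero]; exact hv y)) (hnn x y)
    have h2 : 0 < f x 0 := by
      have h := (hf1 x hx 0 le_rfl).1
      have : 0 ≤ φ1 x * (0 : ℝ) ^ (m1 x - 1) :=
        mul_nonneg (hφ1 x hx).le (Real.rpow_nonneg le_rfl _)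
      linarith [hψ1 x hx]
    have h3 : 0 < lam * f x 0 := mul_pos hlam h2
    simp only [G, hvx] at h1 ⊢
    linarith
  have hpow : ∀ (x : V) (t : ℝ), 0 < t → t ^ (p x - 2) * t = t ^ (p x - 1) := fun x t ht => by
    rw [← Real.rpow_add_one ht.ne']
    ring_nf
  set s : ℝ := 2⁻¹ * (Fintype.card V : ℝ) ^ (-(1 / 2) : ℝ) with hs
  have hNR : (2 : ℝ) ≤ Fintype.card V := by exact_mod_cast hN
  have hs0 : 0 < s := by positivity
  have hs1 : s ≤ 1 := by
    have : (Fintype.card V : ℝ) ^ (-(1 / 2) : ℝ) ≤ 1 :=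
      Real.rpow_le_one_of_one_le_of_nonpos (by linarith) (by norm_num)
    linarith
  have hsuper : ∀ x ∈ S, lam * f x s < q x * s ^ (p x - 1) := by
    intro x hx
    have h := strict_supersolution_of_lt (P := S.sup' hS p) (m := S.inf' hS m2)
      ((hp x).trans (le_sup' p hx)) ((le_inf'_iff hS m2).2 hm2)
      ((lt_inf'_iff hS).2 hq) ((hφ2 x hx).trans_le (le_sup' φ2 hx))
      ((hψ2 x hx).trans_le (le_sup' ψ2 hx)) hNR (Nat.cast_nonneg B.card)
      (by exact_mod_cast card_le_univ B) (by exact_mod_cast hS.card_pos) hlam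
      (hlam2 ▸ hlt)
    rw [← hs] at h
    calc lam * f x s ≤ lam * (φ2 x * s ^ (m2 x - 1) + ψ2 x) := by
          gcongr; exact (hf1 x hx s hs0.le).2
      _ ≤ lam * (S.sup' hS φ2 * s ^ (S.inf' hS m2 - 1) + S.sup' hS ψ2) := by
          have h1 : s ^ (m2 x - 1) ≤ s ^ (S.inf' hS m2 - 1) :=
            Real.rpow_le_rpow_of_exponent_ge hs0 hs1 (by linarith [inf'_le m2 hx])
          have h2 := le_sup' φ2 hx
          have h3 := le_sup' ψ2 hx
          have h4 := (hφ2 x hx).le.trans h2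
          gcongr
      _ < S.inf' hS q * s ^ (S.sup' hS p - 1) := h
      _ ≤ q x * s ^ (p x - 1) := by
          have h1 : s ^ (S.sup' hS p - 1) ≤ s ^ (p x - 1) :=
            Real.rpow_le_rpow_of_exponent_ge hs0 hs1 (by linarith [le_sup' p hx])
          have h2 := inf'_le q hx
          have h3 := hq x hx
          gcongr
  have hGsuper : ∀ v : V → ℝ, (∀ y, v y ≤ s) → ∀ x ∈ S, v x = s → 0 < G v x := by
    intro v hv x hx hvx
    have h1 : ∑ y, |v y - v x| ^ (p x - 2) * (v y - v x) * ω x y ≤ 0 :=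
      sum_nonpos fun y _ => mul_nonpos_of_nonpos_of_nonneg (mul_nonpos_of_nonneg_of_nonpos
        (by positivity) (by rw [hvx]; linarith [hv y])) (hnn x y)
    have h2 := hsuper x hx
    rw [← hpow x s hs0] at h2
    simp only [G, hvx, abs_of_pos hs0] at h1 ⊢
    linarith
  have hpm : ∀ x ∈ S, p x < m1 x := fun x hx =>
    (le_sup' p (mem_univ x)).trans_lt (hm1p.trans_le (inf'_le m1 hx))
  obtain ⟨M, hsM, hM⟩ := exists_large_subsolution S (C := fun x => ∑ y, ω x y + q x)
    (κ := fun x => lam * φ1 x) (fun x hx => mul_pos hlam (hφ1 x hx)) hpm s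
  have hM0 : 0 < M := hs0.trans hsM
  have hGsub : ∀ v : V → ℝ, (∀ y, 0 ≤ v y) → (∀ y, v y ≤ M) → ∀ x ∈ S, v x = M →
      G v x < 0 := by
    intro v hv0 hv x hx hvx
    have h1 : -(∑ y, |v y - v x| ^ (p x - 2) * (v y - v x) * ω x y) ≤
        ∑ y, M ^ (p x - 1) * ω x y := by
      rw [← sum_neg_distrib]
      refine sum_le_sum fun y _ => ?_
      have h2 : 0 ≤ M - v y := by linarith [hv y]
      have h3 : M - v y ≤ M := by linarith [hv0 y]
      have h4 : 0 ≤ p x - 2 := by linarith [hp x]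
      have h5 := hnn x y
      rw [hvx, abs_sub_comm, abs_of_nonneg h2, ← hpow x M hM0]
      calc -((M - v y) ^ (p x - 2) * (v y - M) * ω x y)
          = (M - v y) ^ (p x - 2) * (M - v y) * ω x y := by ring
        _ ≤ M ^ (p x - 2) * M * ω x y := by gcongr
    have h2 := hM x hx
    have h3 := (hf1 x hx M hM0.le).1
    have h4 : lam * (φ1 x * M ^ (m1 x - 1)) < lam * f x M := by
      gcongr
      linarith [hψ1 x hx]
    rw [← mul_sum] at h1
    rw [hvx] at h1
    have h5 := hpow x M hM0
    simp only [G, hvx, abs_of_pos hM0]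
    rw [mul_assoc (q x), h5]
    linarith
  let E : (S → ℝ) → V → ℝ := fun u x => if h : x ∈ S then u ⟨x, h⟩ else 0
  have hES : ∀ u (x : S), E u x = u x := fun u x => by simp [E]
  have hEB : ∀ u, ∀ x ∈ B, E u x = 0 := fun u x hx => by
    simp [E, Finset.disjoint_right.1 hdisj hx]
  have hEcont : ∀ x, Continuous fun u => E u x := fun x => by
    by_cases h : x ∈ S
    · simpa [E, h] using continuous_apply (⟨x, h⟩ : S)
    · simpa [E, h] using continuous_const
  have hEbd : ∀ u c, 0 ≤ c → (∀ x, u x ≤ c) → ∀ y, E u y ≤ c := fun u c hc hu y => by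
    by_cases h : y ∈ S
    · simpa [E, h] using hu ⟨y, h⟩
    · simpa [E, h] using hc
  have hE0 : ∀ u, (∀ x, 0 ≤ u x) → ∀ y, 0 ≤ E u y := fun u hu y => by
    by_cases h : y ∈ S
    · simpa [E, h] using hu ⟨y, h⟩
    · simp [E, h]
  have hG : Continuous fun (u : S → ℝ) (x : S) => G (E u) x := by
    refine continuous_pi fun x => ?_
    have hx := hEcont x
    have hpx : 0 ≤ p x - 2 := by linarith [hp x]
    refine Continuous.sub (Continuous.add (Continuous.neg ?_) ?_)
      (continuous_const.mul ((hfc x x.2).comp hx))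
    · refine continuous_finsetSum _ fun y _ => ?_
      have hd := (hEcont y).sub hx
      exact ((hd.abs.rpow_const fun _ => Or.inr hpx).mul hd).mul continuous_const
    · exact (continuous_const.mul (hx.abs.rpow_const fun _ => Or.inr hpx)).mul hx
  have : Nonempty S := hS.to_subtype
  have hface : ∀ u : S → ℝ, (∀ y, 0 ≤ u y) → ∀ x, u x = 0 → G (E u) x < 0 :=
    fun u hu x hux => hGface _ (hE0 u hu) x x.2 ((hES u x).trans hux)
  have hinner : ∀ u : S → ℝ, (∀ y, 0 ≤ u y) → (∀ y, u y ≤ s) → ∀ x, u x = s → 0 < G (E u) x :=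
    fun u _ hus x hux => hGsuper _ (hEbd u s hs0.le hus) x x.2 ((hES u x).trans hux)
  obtain ⟨u₁, hu₁, hz₁, t₁, ht₁, -, hle₁, -⟩ := exists_pos_zero hG hs0 le_rfl hface hinner
    fun u hu _ => hface u hu
  obtain ⟨u₂, hu₂, hz₂, t₂, ht₂, -, -, x₂, hx₂⟩ := exists_pos_zero hG hs0 hM0.le hface hinner
    fun u hu huM x hux => hGsub _ (hE0 u hu) (hEbd u M hM0.le huM) x x.2 ((hES u x).trans hux)
  have hsol : ∀ u : S → ℝ, (∀ x, 0 < u x) → (∀ x : S, G (E u) x = 0) →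
      (∀ x ∈ B, E u x = 0) ∧ (∀ x ∈ S, 0 < E u x) ∧ ∀ x ∈ S,
        -(∑ y, |E u y - E u x| ^ (p x - 2) * (E u y - E u x) * ω x y)
          + q x * |E u x| ^ (p x - 2) * E u x = lam * f x (E u x) := fun u hu hz =>
    ⟨hEB u, fun x hx => (hES u ⟨x, hx⟩).symm ▸ hu ⟨x, hx⟩,
      fun x hx => sub_eq_zero.1 (hz ⟨x, hx⟩)⟩
  refine ⟨E u₁, E u₂, fun h => ?_, hsol u₁ hu₁ hz₁, hsol u₂ hu₂ hz₂⟩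
  have h1 : u₁ x₂ = u₂ x₂ := by rw [← hES u₁, h, hES]
  have h2 := hle₁ x₂
  have h3 : 0 < t₁ * s := mul_pos ht₁ hs0
  have h4 : 0 < t₂ * (M - s) := mul_pos ht₂ (sub_pos.2 hsM)
  linarith
end
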